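/- Let n ≥ 1 and let k > n/2 be an even integer. Let σ : ℤⁿ → ℂ be a symbol such that for every multi-index α with |α| ≤ k there is C_α > 0 with |Δ_ξ^α σ(ξ)| ≤ C_α ⟨ξ⟩^{−|α|} for all ξ ∈ ℤⁿ. Then the periodic Fourier multiplier σ(D) is of weak type (1,1), i.e. there is C > 0 such that for all λ > 0 and all smooth f, the measure of {x ∈ 𝕋ⁿ : |σ(D)f(x)| > λ} is at most C ‖f‖_{L¹(𝕋ⁿ)}/λ, and σ(D) is bounded on L^p(𝕋ⁿ) for every 1 < p < ∞. -/

import Mathlib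

open MeasureTheory Real ENNReal

noncomputable section

/-- Partial derivative of a complex-valued function on `ℝⁿ` in the `j`-th coordinate
direction. -/
def pd {n : ℕ} (j : Fin n) (f : (Fin n → ℝ) → ℂ) : (Fin n → ℝ) → ℂ :=
  fun x => fderiv ℝ f x (Pi.single j 1)

/-- The canonical list of directions associated to a multi-index `β ∈ ℕⁿ`. -/
def mIdxList {n : ℕ} (β : Fin n → ℕ) : List (Fin n) :=
  (List.finRange n).flatMap fun j => List.replicate (β j) j

/-- Iterated partial derivative `∂^β` associated to a multi-index `β`. -/
def pdM {n : ℕ} (β : Fin n → ℕ) (f : (Fin n → ℝ) → ℂ) : (Fin n → ℝ) → ℂ :=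
  (mIdxList β).foldr pd f

/-- Forward difference operator in the `j`-th direction on functions of `ξ ∈ ℤⁿ`. -/
def dd {n : ℕ} (j : Fin n) (g : (Fin n → ℤ) → ℂ) : (Fin n → ℤ) → ℂ :=
  fun ξ => g (ξ + Pi.single j 1) - g ξ

/-- Iterated difference operator `Δ_ξ^α` associated to a multi-index `α`. -/
def ddM {n : ℕ} (α : Fin n → ℕ) (g : (Fin n → ℤ) → ℂ) : (Fin n → ℤ) → ℂ :=
  (mIdxList α).foldr dd g

/-- Japanese bracket `⟨ξ⟩ = (1+|ξ|²)^{1/2}` of a lattice point `ξ ∈ ℤⁿ`. -/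
def jb {n : ℕ} (ξ : Fin n → ℤ) : ℝ := Real.sqrt (1 + ∑ j, ((ξ j : ℝ)) ^ 2)

/-- Japanese bracket `⟨ξ⟩ = (1+|ξ|²)^{1/2}` of a vector `ξ ∈ ℝⁿ`. -/
def jbR {n : ℕ} (ξ : Fin n → ℝ) : ℝ := Real.sqrt (1 + ∑ j, (ξ j) ^ 2)

/-- The canonical embedding `ℤⁿ → ℝⁿ`. -/
def castZ {n : ℕ} (ξ : Fin n → ℤ) : Fin n → ℝ := fun j => (ξ j : ℝ)

/-- The fundamental domain `[0,1)ⁿ` of the torus `𝕋ⁿ = ℝⁿ/ℤⁿ`. -/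
def cube (n : ℕ) : Set (Fin n → ℝ) := Set.univ.pi fun _ => Set.Ico (0 : ℝ) 1

/-- The normalized Lebesgue measure of the torus `𝕋ⁿ`, realized as the Lebesgue measure
on `ℝⁿ` restricted to the fundamental domain `[0,1)ⁿ`. -/
def μT (n : ℕ) : Measure (Fin n → ℝ) := volume.restrict (cube n)

/-- `1`-periodicity of a function on `ℝⁿ` (i.e. the function descends to `𝕋ⁿ`). -/
def Per {n : ℕ} (f : (Fin n → ℝ) → ℂ) : Prop :=
  ∀ (x : Fin n → ℝ) (v : Fin n → ℤ), f (x + fun j => (v j : ℝ)) = f x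

/-- The character `e^{2πi⟨x,ξ⟩}`. -/
def eChar {n : ℕ} (x : Fin n → ℝ) (ξ : Fin n → ℤ) : ℂ :=
  Complex.exp (2 * (π : ℂ) * Complex.I * ∑ j, (x j : ℂ) * (ξ j : ℂ))

/-- Fourier coefficient `f̂(ξ) = ∫_{𝕋ⁿ} e^{-2πi⟨x,ξ⟩} f(x) dx` of a function on `𝕋ⁿ`. -/
def fc {n : ℕ} (f : (Fin n → ℝ) → ℂ) (ξ : Fin n → ℤ) : ℂ :=
  ∫ x, Complex.exp (-(2 * (π : ℂ) * Complex.I) * ∑ j, (x j : ℂ) * (ξ j : ℂ)) * f x ∂(μT n)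

/-- Periodic pseudo-differential operator
    `σ(x,D)f(x) = Σ_{ξ ∈ ℤⁿ} e^{2πi⟨x,ξ⟩} σ(x,ξ) f̂(ξ)`
with symbol `σ` on `𝕋ⁿ × ℤⁿ`. -/
def Op {n : ℕ} (σ : (Fin n → ℝ) → (Fin n → ℤ) → ℂ) (f : (Fin n → ℝ) → ℂ) :
    (Fin n → ℝ) → ℂ :=
  fun x => ∑' ξ : Fin n → ℤ, eChar x ξ * σ x ξ * fc f ξ

/-- The `L^p(𝕋ⁿ)` norm, for a real exponent `p`. -/
def lpT (n : ℕ) (p : ℝ) (g : (Fin n → ℝ) → ℂ) : ℝ :=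
  (∫ x, ‖g x‖ ^ p ∂(μT n)) ^ (1 / p)

/-- `∂_x^β Δ_ξ^α σ(x,ξ)` for a symbol `σ` on `𝕋ⁿ × ℤⁿ` (difference operator applied first,
then the derivatives in `x`). -/
def symbDxD {n : ℕ} (β α : Fin n → ℕ) (σ : (Fin n → ℝ) → (Fin n → ℤ) → ℂ)
    (x : Fin n → ℝ) (ξ : Fin n → ℤ) : ℂ :=
  pdM β (fun x' => ddM α (σ x') ξ) x

/-- `Δ_ξ^α ∂_x^β σ(x,ξ)` for a symbol `σ` on `𝕋ⁿ × ℤⁿ` (derivatives in `x` applied first,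
then the difference operator in `ξ`). -/
def symbDDx {n : ℕ} (α β : Fin n → ℕ) (σ : (Fin n → ℝ) → (Fin n → ℤ) → ℂ)
    (x : Fin n → ℝ) (ξ : Fin n → ℤ) : ℂ :=
  ddM α (fun ξ' => pdM β (fun x' => σ x' ξ') x) ξ

/-- `∂_ξ^α ∂_x^β σ(x,ξ)` for a symbol `σ` on `𝕋ⁿ × ℝⁿ` (derivatives in `x` applied first,
then the derivatives in `ξ`). -/
def symbDξDx {n : ℕ} (α β : Fin n → ℕ) (σ : (Fin n → ℝ) → (Fin n → ℝ) → ℂ)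
    (x ξ : Fin n → ℝ) : ℂ :=
  pdM α (fun ξ' => pdM β (fun x' => σ x' ξ') x) ξ

/-- `∂_x^β ∂_ξ^α σ(x,ξ)` for a symbol `σ` on `𝕋ⁿ × ℝⁿ` (derivatives in `ξ` applied first,
then the derivatives in `x`). -/
def symbDxDξ {n : ℕ} (β α : Fin n → ℕ) (σ : (Fin n → ℝ) → (Fin n → ℝ) → ℂ)
    (x ξ : Fin n → ℝ) : ℂ :=
  pdM β (fun x' => pdM α (σ x') ξ) x

/-- The Euclidean Fourier transform `û(ξ) = ∫_{ℝⁿ} e^{-2πi⟨x,ξ⟩} u(x) dx`. -/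
def FT {n : ℕ} (u : (Fin n → ℝ) → ℂ) (ξ : Fin n → ℝ) : ℂ :=
  ∫ x, Complex.exp (-(2 * (π : ℂ) * Complex.I) * ∑ j, (x j : ℂ) * (ξ j : ℂ)) * u x

/-- Pseudo-differential operator on `ℝⁿ`:
`T_σ u(x) = ∫_{ℝⁿ} e^{2πi⟨x,ξ⟩} σ(x,ξ) û(ξ) dξ`. -/
def OpR {n : ℕ} (σ : (Fin n → ℝ) → (Fin n → ℝ) → ℂ) (u : (Fin n → ℝ) → ℂ) :
    (Fin n → ℝ) → ℂ :=
  fun x => ∫ ξ, Complex.exp (2 * (π : ℂ) * Complex.I * ∑ j, (x j : ℂ) * (ξ j : ℂ)) * σ x ξ * FT u ξ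

/-- Periodic amplitude operator
`a(x,y,D)u(x) = ∫_{𝕋ⁿ} ∫_{ℝⁿ} e^{2πi⟨x-y,ξ⟩} a(x,y,ξ) u(y) dξ dy`. -/
def OpAmp {n : ℕ} (a : (Fin n → ℝ) → (Fin n → ℝ) → (Fin n → ℝ) → ℂ)
    (u : (Fin n → ℝ) → ℂ) : (Fin n → ℝ) → ℂ :=
  fun x => ∫ y,
    (∫ ξ, Complex.exp (2 * (π : ℂ) * Complex.I * ∑ j, ((x j : ℂ) - (y j : ℂ)) * (ξ j : ℂ)) *
        a x y ξ) * u y ∂(μT n)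

/-- The `L^p(ℝⁿ)` norm, for a real exponent `p`. -/
def lpR (n : ℕ) (p : ℝ) (g : (Fin n → ℝ) → ℂ) : ℝ :=
  (∫ x, ‖g x‖ ^ p) ^ (1 / p)

/-- The normalized Haar measure of the torus `(ℝ/ℤ)ⁿ`. -/
def haarTorus (n : ℕ) : Measure (UnitAddTorus (Fin n)) :=
  Measure.pi fun _ => AddCircle.haarAddCircle

instance (n : ℕ) : IsProbabilityMeasure (haarTorus n) := by
  unfold haarTorus; infer_instance

instance (n : ℕ) : (haarTorus n).IsAddHaarMeasure := by
  unfold haarTorus; infer_instance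

/-- Fourier coefficients with respect to `haarTorus`. -/
def torusCoeff {n : ℕ} (g : UnitAddTorus (Fin n) → ℂ) (ξ : Fin n → ℤ) : ℂ :=
  ∫ t, UnitAddTorus.mFourier (-ξ) t * g t ∂(haarTorus n)

/-- The trigonometric series with coefficients `m`. -/
def trigSeries {n : ℕ} (m : (Fin n → ℤ) → ℂ) (x : UnitAddTorus (Fin n)) : ℂ :=
  ∑' ξ, m ξ * UnitAddTorus.mFourier ξ x

/-- The Fourier multiplier with symbol `m`, acting on functions on the torus. -/
def torusMul {n : ℕ} (m : (Fin n → ℤ) → ℂ) (g : UnitAddTorus (Fin n) → ℂ) :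
    UnitAddTorus (Fin n) → ℂ :=
  trigSeries fun ξ => m ξ * torusCoeff g ξ

section Trig

variable {n : ℕ}

lemma norm_mFourier_apply (ξ : Fin n → ℤ) (x : UnitAddTorus (Fin n)) :
    ‖UnitAddTorus.mFourier ξ x‖ = 1 := by
  simp [UnitAddTorus.mFourier, fourier_apply, Circle.norm_coe]

lemma mFourier_add_apply (ξ : Fin n → ℤ) (x y : UnitAddTorus (Fin n)) :
    UnitAddTorus.mFourier ξ (x + y) = UnitAddTorus.mFourier ξ x * UnitAddTorus.mFourier ξ y := by
  simp [UnitAddTorus.mFourier, fourier_apply, ← Finset.prod_mul_distrib, smul_add,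
    AddCircle.toCircle_add]

lemma mFourier_neg_apply (ξ : Fin n → ℤ) (x : UnitAddTorus (Fin n)) :
    UnitAddTorus.mFourier ξ (-x) = UnitAddTorus.mFourier (-ξ) x := by
  simp [UnitAddTorus.mFourier, fourier_apply]

lemma trigSeries_eq_sum {m : (Fin n → ℤ) → ℂ} {S : Finset (Fin n → ℤ)}
    (hS : ∀ ξ ∉ S, m ξ = 0) (x : UnitAddTorus (Fin n)) :
    trigSeries m x = ∑ ξ ∈ S, m ξ * UnitAddTorus.mFourier ξ x :=
  tsum_eq_sum fun ξ h => by simp [hS ξ h]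

lemma exists_finset_of_support {m : (Fin n → ℤ) → ℂ} (hm : m.support.Finite) :
    ∃ S : Finset (Fin n → ℤ), ∀ ξ ∉ S, m ξ = 0 :=
  ⟨hm.toFinset, fun ξ h => by simpa using h⟩

lemma continuous_trigSeries {m : (Fin n → ℤ) → ℂ} (hm : m.support.Finite) :
    Continuous (trigSeries m) := by
  obtain ⟨S, hS⟩ := exists_finset_of_support hm
  rw [funext (trigSeries_eq_sum hS)]
  fun_prop

lemma integral_sq_trigSeries {m : (Fin n → ℤ) → ℂ} {S : Finset (Fin n → ℤ)}
    (hS : ∀ ξ ∉ S, m ξ = 0) :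
    ∫ x, ‖trigSeries m x‖ ^ 2 ∂(haarTorus n) = ∑ ξ ∈ S, ‖m ξ‖ ^ 2 := by
  have h := UnitAddTorus.orthonormal_mFourier (d := Fin n)
  have h2 := h.inner_sum m m S
  have h3 : ∑ i ∈ S, m i • UnitAddTorus.mFourierLp (d := Fin n) 2 i
      = ContinuousMap.toLp (E := ℂ) 2 (haarTorus n) ℂ
        (∑ i ∈ S, m i • UnitAddTorus.mFourier i) := by
    rw [map_sum]; rfl
  have h4 : inner ℂ (ContinuousMap.toLp (E := ℂ) 2 (haarTorus n) ℂ
        (∑ i ∈ S, m i • UnitAddTorus.mFourier i)) (ContinuousMap.toLp (E := ℂ) 2 (haarTorus n) ℂ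
        (∑ i ∈ S, m i • UnitAddTorus.mFourier i))
      = ∑ i ∈ S, (starRingEnd ℂ) (m i) * m i := by
    rw [← h2]
    erw [h3]
    rfl
  rw [ContinuousMap.inner_toLp] at h4
  have h5 : ∀ x, (∑ i ∈ S, m i • UnitAddTorus.mFourier i : C(UnitAddTorus (Fin n), ℂ)) x
      = trigSeries m x := by
    intro x; rw [trigSeries_eq_sum hS]; simp
  simp only [h5, Complex.mul_conj', Complex.conj_mul'] at h4
  have h6 : ((∫ x, ‖trigSeries m x‖ ^ 2 ∂(haarTorus n) : ℝ) : ℂ)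
      = ((∑ ξ ∈ S, ‖m ξ‖ ^ 2 : ℝ) : ℂ) := by
    rw [← integral_complex_ofReal]
    push_cast
    exact h4
  exact_mod_cast h6

lemma hasSum_sq_torusCoeff {g : UnitAddTorus (Fin n) → ℂ} (hg : MemLp g 2 (haarTorus n)) :
    HasSum (fun ξ => ‖torusCoeff g ξ‖ ^ 2) (∫ x, ‖g x‖ ^ 2 ∂(haarTorus n)) := by
  have h := UnitAddTorus.hasSum_sq_mFourierCoeff (hg.toLp g)
  have e := hg.coeFn_toLp
  have e1 : ∀ ξ, UnitAddTorus.mFourierCoeff (hg.toLp g) ξ = torusCoeff g ξ := by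
    intro ξ
    refine integral_congr_ae ?_
    filter_upwards [e] with x hx
    simp [hx]
  have e2 : ∫ x, ‖(hg.toLp g) x‖ ^ 2 ∂(haarTorus n) = ∫ x, ‖g x‖ ^ 2 ∂(haarTorus n) := by
    refine integral_congr_ae ?_
    filter_upwards [e] with x hx
    simp [hx]
  rw [← e2, show (fun ξ => ‖torusCoeff g ξ‖ ^ 2) = fun ξ =>
    ‖UnitAddTorus.mFourierCoeff (hg.toLp g) ξ‖ ^ 2 from funext fun ξ => by rw [e1]]
  exact h

lemma finite_support_mul {m : (Fin n → ℤ) → ℂ} (hm : m.support.Finite) (c : (Fin n → ℤ) → ℂ) :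
    (fun ξ => m ξ * c ξ).support.Finite :=
  hm.subset fun ξ h => by
    intro h0
    exact h (by simp [h0])

lemma continuous_torusMul {m : (Fin n → ℤ) → ℂ} (hm : m.support.Finite)
    (g : UnitAddTorus (Fin n) → ℂ) : Continuous (torusMul m g) :=
  continuous_trigSeries (finite_support_mul hm _)

lemma integral_sq_torusMul_le {m : (Fin n → ℤ) → ℂ} (hm : m.support.Finite) {A : ℝ}
    (hA : ∀ ξ, ‖m ξ‖ ≤ A) {g : UnitAddTorus (Fin n) → ℂ} (hg : MemLp g 2 (haarTorus n)) :
    ∫ x, ‖torusMul m g x‖ ^ 2 ∂(haarTorus n) ≤ A ^ 2 * ∫ x, ‖g x‖ ^ 2 ∂(haarTorus n) := by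
  obtain ⟨S, hS⟩ := exists_finset_of_support hm
  unfold torusMul
  rw [integral_sq_trigSeries (S := S) (fun ξ h => by simp [hS ξ h])]
  have h := hasSum_sq_torusCoeff hg
  have h1 := h.summable.sum_le_tsum S (fun _ _ => by positivity)
  rw [h.tsum_eq] at h1
  calc ∑ ξ ∈ S, ‖m ξ * torusCoeff g ξ‖ ^ 2
      ≤ ∑ ξ ∈ S, A ^ 2 * ‖torusCoeff g ξ‖ ^ 2 := by
        refine Finset.sum_le_sum fun ξ _ => ?_
        rw [norm_mul, mul_pow]
        gcongr
        exact hA ξ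
    _ ≤ _ := by rw [← Finset.mul_sum]; gcongr

lemma integrable_mFourier_mul {g : UnitAddTorus (Fin n) → ℂ} (hg : Integrable g (haarTorus n))
    (ξ : Fin n → ℤ) : Integrable (fun x => UnitAddTorus.mFourier ξ x * g x) (haarTorus n) :=
  hg.bdd_mul (c := 1) (by fun_prop) (by simp [norm_mFourier_apply])

lemma torusMul_eq_integral {m : (Fin n → ℤ) → ℂ} (hm : m.support.Finite)
    {g : UnitAddTorus (Fin n) → ℂ} (hg : Integrable g (haarTorus n)) (x : UnitAddTorus (Fin n)) :
    torusMul m g x = ∫ y, trigSeries m (x - y) * g y ∂(haarTorus n) := by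
  obtain ⟨S, hS⟩ := exists_finset_of_support hm
  unfold torusMul
  rw [trigSeries_eq_sum (S := S) (fun ξ h => by simp [hS ξ h])]
  simp_rw [trigSeries_eq_sum hS, Finset.sum_mul, sub_eq_add_neg, mFourier_add_apply,
    mFourier_neg_apply]
  rw [integral_finsetSum]
  · refine Finset.sum_congr rfl fun ξ _ => ?_
    simp_rw [mul_assoc]
    rw [integral_const_mul, integral_const_mul]
    unfold torusCoeff
    ring
  · intro ξ _
    simp_rw [mul_assoc]
    exact ((integrable_mFourier_mul hg _).const_mul _).const_mul _

lemma torusCoeff_add {g h : UnitAddTorus (Fin n) → ℂ} (hg : Integrable g (haarTorus n))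
    (hh : Integrable h (haarTorus n)) (ξ : Fin n → ℤ) :
    torusCoeff (fun x => g x + h x) ξ = torusCoeff g ξ + torusCoeff h ξ := by
  unfold torusCoeff
  simp_rw [mul_add]
  exact integral_add (integrable_mFourier_mul hg _) (integrable_mFourier_mul hh _)

lemma torusMul_add {m : (Fin n → ℤ) → ℂ} (hm : m.support.Finite)
    {g h : UnitAddTorus (Fin n) → ℂ} (hg : Integrable g (haarTorus n))
    (hh : Integrable h (haarTorus n)) (x : UnitAddTorus (Fin n)) :
    torusMul m (fun x => g x + h x) x = torusMul m g x + torusMul m h x := by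
  obtain ⟨S, hS⟩ := exists_finset_of_support hm
  unfold torusMul
  rw [trigSeries_eq_sum (S := S) (fun ξ h => by simp [hS ξ h]),
    trigSeries_eq_sum (S := S) (fun ξ h => by simp [hS ξ h]),
    trigSeries_eq_sum (S := S) (fun ξ h => by simp [hS ξ h]), ← Finset.sum_add_distrib]
  refine Finset.sum_congr rfl fun ξ _ => ?_
  rw [torusCoeff_add hg hh]
  ring

lemma torusCoeff_conj (f : UnitAddTorus (Fin n) → ℂ) (ξ : Fin n → ℤ) :
    ∫ x, UnitAddTorus.mFourier ξ x * (starRingEnd ℂ) (f x) ∂(haarTorus n)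
      = (starRingEnd ℂ) (torusCoeff f ξ) := by
  unfold torusCoeff
  rw [← integral_conj]
  simp [UnitAddTorus.mFourier_neg]

lemma integral_torusMul_mul_conj {m : (Fin n → ℤ) → ℂ} {S : Finset (Fin n → ℤ)}
    (hS : ∀ ξ ∉ S, m ξ = 0) (f : UnitAddTorus (Fin n) → ℂ)
    {g : UnitAddTorus (Fin n) → ℂ} (hg : Integrable g (haarTorus n)) :
    ∫ x, torusMul m f x * (starRingEnd ℂ) (g x) ∂(haarTorus n)
      = ∑ ξ ∈ S, m ξ * torusCoeff f ξ * (starRingEnd ℂ) (torusCoeff g ξ) := by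
  have hg' : Integrable (fun x => (starRingEnd ℂ) (g x)) (haarTorus n) := by
    refine hg.mono (by fun_prop) (.of_forall fun x => by simp)
  unfold torusMul
  simp_rw [trigSeries_eq_sum (S := S) (m := fun ξ => m ξ * torusCoeff f ξ)
    (fun ξ h => by simp [hS ξ h]), Finset.sum_mul]
  rw [integral_finsetSum]
  · refine Finset.sum_congr rfl fun ξ _ => ?_
    simp_rw [mul_assoc]
    rw [integral_const_mul, integral_const_mul, torusCoeff_conj]
  · intro ξ _
    simp_rw [mul_assoc]
    exact ((integrable_mFourier_mul hg' _).const_mul _).const_mul _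

lemma integral_torusMul_mul_conj_eq {m : (Fin n → ℤ) → ℂ} (hm : m.support.Finite)
    {f g : UnitAddTorus (Fin n) → ℂ} (hf : Integrable f (haarTorus n))
    (hg : Integrable g (haarTorus n)) :
    ∫ x, torusMul m f x * (starRingEnd ℂ) (g x) ∂(haarTorus n)
      = ∫ x, f x * (starRingEnd ℂ) (torusMul (fun ξ => (starRingEnd ℂ) (m ξ)) g x)
          ∂(haarTorus n) := by
  obtain ⟨S, hS⟩ := exists_finset_of_support hm
  have h := integral_torusMul_mul_conj (m := fun ξ => (starRingEnd ℂ) (m ξ)) (S := S)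
    (fun ξ h => by simp [hS ξ h]) g hf
  rw [integral_torusMul_mul_conj hS f hg]
  have h2 := congrArg (starRingEnd ℂ) h
  rw [← integral_conj] at h2
  simp only [map_mul, map_sum, Complex.conj_conj] at h2
  calc _ = _ := Finset.sum_congr rfl fun ξ _ => by ring
    _ = _ := h2.symm
    _ = _ := integral_congr_ae (.of_forall fun x => by simp [mul_comm])

end Trig

lemma exists_real_rep (y : UnitAddCircle) : ∃ t : ℝ, (t : UnitAddCircle) = y ∧ |t| = ‖y‖ := by
  obtain ⟨t, rfl⟩ := QuotientAddGroup.mk_surjective y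
  refine ⟨t - round t, ?_, ?_⟩
  · rw [AddCircle.coe_sub, sub_eq_self]
    exact (AddCircle.coe_eq_zero_iff (1 : ℝ)).2 ⟨round t, by simp⟩
  · exact UnitAddCircle.norm_eq.symm

lemma norm_le_half (y : UnitAddCircle) : ‖y‖ ≤ 1 / 2 := by
  simpa using AddCircle.norm_le_half_period (p := (1 : ℝ)) (x := y) one_ne_zero

lemma norm_fourier_one_sub_one (t : ℝ) :
    ‖(fourier 1 (t : UnitAddCircle) : ℂ) - 1‖ = 2 * |Real.sin (π * t)| := by
  have h := Complex.norm_exp_I_mul_ofReal_sub_one (2 * π * t)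
  rw [fourier_one, AddCircle.toCircle_apply_mk, Circle.coe_exp]
  rw [show (2 * π * t) / 2 = π * t by ring, norm_mul, Real.norm_eq_abs, Real.norm_eq_abs,
    abs_of_pos (by norm_num : (0 : ℝ) < 2)] at h
  rw [← h]
  congr 3
  push_cast
  ring

lemma norm_fourier_one_sub_one_le (y : UnitAddCircle) :
    ‖(fourier 1 y : ℂ) - 1‖ ≤ 2 * π * ‖y‖ := by
  obtain ⟨t, rfl, ht⟩ := exists_real_rep y
  rw [norm_fourier_one_sub_one, ← ht]
  have := Real.abs_sin_le_abs (x := π * t)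
  rw [abs_mul, abs_of_pos pi_pos] at this
  linarith

lemma four_mul_norm_le (y : UnitAddCircle) : 4 * ‖y‖ ≤ ‖(fourier 1 y : ℂ) - 1‖ := by
  have h2 := norm_le_half y
  obtain ⟨t, rfl, ht⟩ := exists_real_rep y
  rw [norm_fourier_one_sub_one, ← ht]
  rw [← ht] at h2
  have h := Real.mul_le_sin (x := π * |t|) (by positivity) (by nlinarith [pi_pos])
  have h3 : |Real.sin (π * t)| = Real.sin (π * |t|) := by
    rcases abs_cases t with ⟨h, h'⟩ | ⟨h, h'⟩
    · rw [h, abs_of_nonneg]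
      rw [h] at h2
      exact Real.sin_nonneg_of_nonneg_of_le_pi (by positivity) (by nlinarith [pi_pos])
    · rw [h, mul_neg, Real.sin_neg, abs_of_nonpos]
      have : 0 ≤ Real.sin (π * (-t)) := by
        rw [h] at h2
        exact Real.sin_nonneg_of_nonneg_of_le_pi (mul_nonneg pi_pos.le (by linarith))
          (by nlinarith [pi_pos])
      rw [mul_neg, Real.sin_neg] at this
      linarith
  rw [h3]
  have h4 : 2 / π * (π * |t|) = 2 * |t| := by field_simp
  linarith

section Differences

variable {n : ℕ}

lemma iterate_dd_succ_apply (l : Fin n) (i : ℕ) (g : (Fin n → ℤ) → ℂ) (ξ : Fin n → ℤ) :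
    (dd l)^[i + 1] g ξ = (dd l)^[i] g (ξ + Pi.single l 1) - (dd l)^[i] g ξ := by
  rw [Function.iterate_succ_apply']
  rfl

lemma iterate_dd_add (l : Fin n) (i : ℕ) (f g : (Fin n → ℤ) → ℂ) (ξ : Fin n → ℤ) :
    (dd l)^[i] (fun ξ => f ξ + g ξ) ξ = (dd l)^[i] f ξ + (dd l)^[i] g ξ := by
  induction i generalizing ξ with
  | zero => rfl
  | succ i ih => rw [iterate_dd_succ_apply, iterate_dd_succ_apply, iterate_dd_succ_apply, ih, ih]; ring

lemma iterate_dd_conj (l : Fin n) (i : ℕ) (f : (Fin n → ℤ) → ℂ) (ξ : Fin n → ℤ) :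
    (dd l)^[i] (fun ξ => (starRingEnd ℂ) (f ξ)) ξ = (starRingEnd ℂ) ((dd l)^[i] f ξ) := by
  induction i generalizing ξ with
  | zero => rfl
  | succ i ih => rw [iterate_dd_succ_apply, iterate_dd_succ_apply, ih, ih, map_sub]

lemma norm_add_single_le (ξ : Fin n → ℤ) (l : Fin n) : ‖ξ‖ ≤ ‖ξ + Pi.single l 1‖ + 1 := by
  have h := norm_sub_le (ξ + Pi.single l 1) (Pi.single l 1)
  rw [add_sub_cancel_right] at h
  simpa [Pi.norm_single] using h

lemma norm_add_single_le' (ξ : Fin n → ℤ) (l : Fin n) : ‖ξ + Pi.single l 1‖ ≤ ‖ξ‖ + 1 := by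
  simpa [Pi.norm_single] using norm_add_le ξ (Pi.single l 1)

lemma iterate_dd_eq_zero_of_lt_norm {m : (Fin n → ℤ) → ℂ} {R : ℝ} (hm : ∀ ξ, R < ‖ξ‖ → m ξ = 0)
    (l : Fin n) (i : ℕ) (ξ : Fin n → ℤ) (h : R + i < ‖ξ‖) : (dd l)^[i] m ξ = 0 := by
  induction i generalizing ξ with
  | zero => exact hm ξ (by simpa using h)
  | succ i ih =>
    push_cast at h
    have := norm_add_single_le ξ l
    rw [iterate_dd_succ_apply, ih _ (by linarith), ih _ (by linarith), sub_zero]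

lemma iterate_dd_eq_zero_of_norm_le {m : (Fin n → ℤ) → ℂ} {R : ℝ} (hm : ∀ ξ, ‖ξ‖ ≤ R → m ξ = 0)
    (l : Fin n) (i : ℕ) (ξ : Fin n → ℤ) (h : ‖ξ‖ + i ≤ R) : (dd l)^[i] m ξ = 0 := by
  induction i generalizing ξ with
  | zero => exact hm ξ (by simpa using h)
  | succ i ih =>
    push_cast at h
    have := norm_add_single_le' ξ l
    rw [iterate_dd_succ_apply, ih _ (by linarith), ih _ (by linarith), sub_zero]

/-- Leibniz-type bound for iterated differences of a product. -/
lemma norm_iterate_dd_mul_le (l : Fin n) (i : ℕ) {r : ℝ} {ξ : Fin n → ℤ}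
    {f g : (Fin n → ℤ) → ℂ} {A B : ℝ}
    (hf : ∀ a ≤ i, ‖(dd l)^[a] f ξ‖ ≤ A * r ^ a)
    (hg : ∀ b ≤ i, ∀ η, ‖(dd l)^[b] g η‖ ≤ B * r ^ b) :
    ‖(dd l)^[i] (fun η => f η * g η) ξ‖ ≤ A * B * (2 * r) ^ i := by
  induction i generalizing f g A B with
  | zero =>
    simp only [Function.iterate_zero, id, pow_zero, mul_one, norm_mul]
    have h1 := hf 0 le_rfl
    have h2 := hg 0 le_rfl ξ
    simp only [Function.iterate_zero, id, pow_zero, mul_one] at h1 h2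
    exact mul_le_mul h1 h2 (norm_nonneg _) ((norm_nonneg _).trans h1)
  | succ i ih =>
    have e : dd l (fun η => f η * g η)
        = fun η => dd l f η * g (η + Pi.single l 1) + f η * dd l g η := by
      funext η
      simp only [dd]
      ring
    rw [Function.iterate_succ_apply, e]
    refine (congrArg norm (iterate_dd_add l i (fun η => dd l f η * g (η + Pi.single l 1))
      (fun η => f η * dd l g η) ξ)).trans_le ?_
    have shift : ∀ b η, (dd l)^[b] (fun η => g (η + Pi.single l 1)) η
        = (dd l)^[b] g (η + Pi.single l 1) := by
      intro b
      induction b with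
      | zero => intro η; rfl
      | succ b ihb => intro η; rw [iterate_dd_succ_apply, iterate_dd_succ_apply, ihb, ihb]
    have h1 := ih (f := dd l f) (g := fun η => g (η + Pi.single l 1)) (A := A * r) (B := B)
      (fun a ha => by
        have := hf (a + 1) (by omega)
        rw [Function.iterate_succ_apply] at this
        exact this.trans_eq (by ring))
      (fun b hb η => by rw [shift]; exact hg b (by omega) _)
    have h2 := ih (f := f) (g := dd l g) (A := A) (B := B * r)
      (fun a ha => hf a (by omega))
      (fun b hb η => by
        have := hg (b + 1) (by omega) η
        rw [Function.iterate_succ_apply] at this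
        exact this.trans_eq (by ring))
    refine (norm_add_le _ _).trans ((add_le_add h1 h2).trans_eq ?_)
    ring

/-- The lattice points of sup norm at most `N`. -/
def latticeBox (n N : ℕ) : Finset (Fin n → ℤ) :=
  Fintype.piFinset fun _ => Finset.Icc (-(N : ℤ)) N

lemma card_latticeBox (n N : ℕ) : (latticeBox n N).card = (2 * N + 1) ^ n := by
  simp only [latticeBox, Fintype.card_piFinset, Int.card_Icc, Finset.prod_const, Finset.card_univ,
    Fintype.card_fin]
  congr 1
  omega

lemma lt_norm_of_notMem_latticeBox {N : ℕ} {ξ : Fin n → ℤ} (h : ξ ∉ latticeBox n N) :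
    (N : ℝ) < ‖ξ‖ := by
  by_contra! h'
  refine h (Fintype.mem_piFinset.2 fun l => ?_)
  have := (norm_le_pi_norm ξ l).trans h'
  rw [Int.norm_eq_abs] at this
  have h2 : |ξ l| ≤ (N : ℤ) := by exact_mod_cast this
  rw [Finset.mem_Icc]
  exact abs_le.1 h2

lemma finite_support_of_norm {m : (Fin n → ℤ) → ℂ} {N : ℕ} (hm : ∀ ξ, (N : ℝ) < ‖ξ‖ → m ξ = 0) :
    m.support.Finite :=
  (latticeBox n N).finite_toSet.subset fun ξ h => by
    by_contra h'
    exact h (hm ξ (lt_norm_of_notMem_latticeBox h'))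

lemma tsum_shift_sub {F : (Fin n → ℤ) → ℂ} (hF : Summable F) (v : Fin n → ℤ) (c : ℂ) :
    ∑' ξ, (c * F (ξ + v) - F ξ) = (c - 1) * ∑' ξ, F ξ := by
  have s2 : Summable fun ξ => F (ξ + v) := (Equiv.addRight v).summable_iff.2 hF
  have s3 : ∑' ξ, F (ξ + v) = ∑' ξ, F ξ := (Equiv.addRight v).tsum_eq F
  rw [Summable.tsum_sub (s2.mul_left _) hF, tsum_mul_left, s3, sub_mul, one_mul]

lemma trigSeries_dd {m : (Fin n → ℤ) → ℂ} (hm : m.support.Finite) (l : Fin n)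
    (x : UnitAddTorus (Fin n)) :
    trigSeries (dd l m) x = ((fourier 1 (-(x l)) : ℂ) - 1) * trigSeries m x := by
  have s1 : Summable fun ξ => m ξ * UnitAddTorus.mFourier ξ x :=
    summable_of_hasFiniteSupport (finite_support_mul hm _)
  have h1 : (fourier 1 (-(x l)) : ℂ) * UnitAddTorus.mFourier (Pi.single l 1) x = 1 := by
    rw [UnitAddTorus.mFourier_single, fourier_one, fourier_one, ← Circle.coe_mul,
      ← AddCircle.toCircle_add]
    simp
  refine Eq.trans (tsum_congr fun ξ => ?_) (tsum_shift_sub s1 (Pi.single l 1) _)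
  rw [UnitAddTorus.mFourier_add, dd]
  linear_combination (-(m (ξ + Pi.single l 1) * UnitAddTorus.mFourier ξ x)) * h1

lemma finite_support_dd {m : (Fin n → ℤ) → ℂ} (hm : m.support.Finite) (l : Fin n) :
    (dd l m).support.Finite := by
  have h := hm.preimage (f := fun ξ : Fin n → ℤ => ξ + Pi.single l 1)
    (fun _ _ _ _ h => add_right_cancel h)
  refine (hm.union h).subset fun ξ hξ => ?_
  by_contra h'
  simp only [Set.mem_union, Function.mem_support, Set.mem_preimage, not_or, not_not] at h'
  exact hξ (by simp [dd, h'.1, h'.2])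

lemma trigSeries_iterate_dd {m : (Fin n → ℤ) → ℂ} (hm : m.support.Finite) (l : Fin n) (i : ℕ)
    (x : UnitAddTorus (Fin n)) :
    trigSeries ((dd l)^[i] m) x = ((fourier 1 (-(x l)) : ℂ) - 1) ^ i * trigSeries m x := by
  induction i generalizing m with
  | zero => simp
  | succ i ih =>
    rw [Function.iterate_succ_apply, ih (finite_support_dd hm l), trigSeries_dd hm]
    ring

lemma integrable_of_continuous {E : Type*} [NormedAddCommGroup E] {f : UnitAddTorus (Fin n) → E}
    (hf : Continuous f) : Integrable f (haarTorus n) := by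
  have := hf.continuousOn.integrableOn_compact (μ := haarTorus n) isCompact_univ
  rwa [integrableOn_univ] at this

end Differences

lemma haarAddCircle_eq_volume :
    (AddCircle.haarAddCircle : Measure UnitAddCircle) = volume := by
  simp [AddCircle.volume_eq_smul_haarAddCircle]

lemma exists_integral_decay_circle {r : ℝ} (hr : 1 < r) :
    ∃ C : ℝ, 0 ≤ C ∧ ∀ R : ℝ, 0 < R →
      ∫ y : UnitAddCircle, (1 + R * ‖y‖) ^ (-r) ∂AddCircle.haarAddCircle ≤ C / R := by
  refine ⟨∫ t : ℝ, (1 + ‖t‖) ^ (-r), integral_nonneg fun t => by positivity, fun R hR => ?_⟩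
  have hint : Integrable (fun t : ℝ => (1 + ‖t‖) ^ (-r)) :=
    integrable_one_add_norm (by simpa using hr)
  have hint2 : Integrable (fun t : ℝ => (1 + ‖R * t‖) ^ (-r)) := hint.comp_mul_left' hR.ne'
  rw [haarAddCircle_eq_volume, ← UnitAddCircle.integral_preimage (-(1 / 2))]
  calc ∫ a in Set.Ioc (-(1 / 2) : ℝ) (-(1 / 2) + 1), (1 + R * ‖(a : UnitAddCircle)‖) ^ (-r)
      = ∫ a in Set.Ioc (-(1 / 2) : ℝ) (-(1 / 2) + 1), (1 + ‖R * a‖) ^ (-r) := by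
        refine setIntegral_congr_fun measurableSet_Ioc fun a ha => ?_
        have h : ‖(a : UnitAddCircle)‖ = |a| := by
          rw [AddCircle.norm_coe_eq_abs_iff _ one_ne_zero, abs_one, abs_le]
          constructor <;> linarith [ha.1, ha.2]
        simp only [h, norm_mul, Real.norm_eq_abs, abs_of_pos hR]
    _ ≤ ∫ a : ℝ, (1 + ‖R * a‖) ^ (-r) :=
        setIntegral_le_integral hint2 (.of_forall fun t => by positivity)
    _ = _ := by
        rw [Measure.integral_comp_mul_left (fun t : ℝ => (1 + ‖t‖) ^ (-r)), smul_eq_mul,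
          abs_of_pos (inv_pos.2 hR)]
        ring

lemma exists_integral_decay {n : ℕ} (hn : 1 ≤ n) {s : ℝ} (hs : n < s) :
    ∃ C : ℝ, 0 ≤ C ∧ ∀ R : ℝ, 0 < R →
      ∫ x, (1 + R * ‖x‖) ^ (-s) ∂(haarTorus n) ≤ C / R ^ n := by
  have hn0 : (0 : ℝ) < n := by exact_mod_cast hn
  obtain ⟨C, hC0, hC⟩ := exists_integral_decay_circle (r := s / n) (by rwa [one_lt_div hn0])
  refine ⟨C ^ n, by positivity, fun R hR => ?_⟩
  have hpos : ∀ t : ℝ, 0 ≤ t → 0 < 1 + R * t := fun t ht => by positivity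
  calc ∫ x, (1 + R * ‖x‖) ^ (-s) ∂(haarTorus n)
      ≤ ∫ x, ∏ l, (1 + R * ‖x l‖) ^ (-(s / n)) ∂(haarTorus n) := by
        refine integral_mono (integrable_of_continuous ?_) (integrable_of_continuous ?_) fun x => ?_
        · exact Continuous.rpow_const (by fun_prop) fun x => Or.inl (hpos _ (norm_nonneg _)).ne'
        · exact continuous_finsetProd _ fun l _ => Continuous.rpow_const (by fun_prop)
            fun x => Or.inl (hpos _ (norm_nonneg _)).ne'
        · have h : (1 + R * ‖x‖) ^ (-s) = ∏ l : Fin n, (1 + R * ‖x‖) ^ (-(s / n)) := by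
            rw [Finset.prod_const, Finset.card_univ, Fintype.card_fin, ← Real.rpow_natCast,
              ← Real.rpow_mul (hpos _ (norm_nonneg _)).le]
            congr 1
            field_simp
          change (1 + R * ‖x‖) ^ (-s) ≤ _
          rw [h]
          refine Finset.prod_le_prod (fun l _ => by positivity) fun l _ => ?_
          refine Real.rpow_le_rpow_of_nonpos (hpos _ (norm_nonneg _)) ?_ ?_
          · gcongr
            exact norm_le_pi_norm x l
          · have : 0 ≤ s / n := div_nonneg (hn0.le.trans hs.le) hn0.le
            linarith
    _ = ∏ l : Fin n, ∫ y : UnitAddCircle, (1 + R * ‖y‖) ^ (-(s / n)) ∂AddCircle.haarAddCircle :=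
        integral_fintype_prod_eq_prod (𝕜 := ℝ)
          (fun _ (y : UnitAddCircle) => (1 + R * ‖y‖) ^ (-(s / n)))
    _ ≤ ∏ l : Fin n, C / R :=
        Finset.prod_le_prod (fun l _ => integral_nonneg fun y => by positivity) fun l _ => hC R hR
    _ = _ := by simp

lemma one_add_pow_le_sum {n : ℕ} (k : ℕ) {R : ℝ} (hR : 0 ≤ R) (x : UnitAddTorus (Fin n)) :
    (1 + R * ‖x‖) ^ (2 * k) ≤ 2 ^ (2 * k) * (1 + ∑ l, R ^ (2 * k) * ‖x l‖ ^ (2 * k)) := by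
  have hsum : 0 ≤ ∑ l, R ^ (2 * k) * ‖x l‖ ^ (2 * k) :=
    Finset.sum_nonneg fun l _ => by positivity
  have h0 : 0 ≤ R * ‖x‖ := by positivity
  have key : (R * ‖x‖) ^ (2 * k) ≤ 1 + ∑ l, R ^ (2 * k) * ‖x l‖ ^ (2 * k) := by
    rcases Nat.eq_zero_or_pos n with rfl | hn
    · have h : ‖x‖ = 0 := by rw [Subsingleton.elim x 0, norm_zero]
      rw [h, mul_zero]
      linarith [pow_le_one₀ le_rfl zero_le_one (n := 2 * k) (a := (0 : ℝ))]
    · have : Nonempty (Fin n) := ⟨⟨0, hn⟩⟩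
      obtain ⟨l, -, hl⟩ := Finset.exists_max_image Finset.univ (fun l => ‖x l‖)
        Finset.univ_nonempty
      have hx : ‖x‖ ≤ ‖x l‖ := (pi_norm_le_iff_of_nonneg (norm_nonneg _)).2 fun i => hl i (by simp)
      calc (R * ‖x‖) ^ (2 * k) ≤ (R * ‖x l‖) ^ (2 * k) := by gcongr
        _ = R ^ (2 * k) * ‖x l‖ ^ (2 * k) := mul_pow _ _ _
        _ ≤ ∑ l, R ^ (2 * k) * ‖x l‖ ^ (2 * k) :=
            Finset.single_le_sum (f := fun l => R ^ (2 * k) * ‖x l‖ ^ (2 * k))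
              (fun i _ => by positivity) (Finset.mem_univ l)
        _ ≤ _ := by linarith
  rcases le_total (R * ‖x‖) 1 with h | h
  · calc (1 + R * ‖x‖) ^ (2 * k) ≤ 2 ^ (2 * k) := by gcongr; linarith
      _ ≤ _ := le_mul_of_one_le_right (by positivity) (by linarith)
  · calc (1 + R * ‖x‖) ^ (2 * k) ≤ (2 * (R * ‖x‖)) ^ (2 * k) := by gcongr; linarith
      _ = 2 ^ (2 * k) * (R * ‖x‖) ^ (2 * k) := mul_pow _ _ _
      _ ≤ _ := by gcongr

/-- Bound for the weighted `L²` norm of a kernel whose symbol is supported in a box. -/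
lemma integral_weighted_sq_trigSeries_le {n k R : ℕ} {A : ℝ}
    (hR : 1 ≤ R) {m : (Fin n → ℤ) → ℂ}
    (hm : ∀ ξ, (R : ℝ) < ‖ξ‖ → m ξ = 0) (h0 : ∀ ξ, ‖m ξ‖ ≤ A)
    (hk : ∀ l ξ, ‖(dd l)^[k] m ξ‖ ≤ A / (R : ℝ) ^ k) :
    ∫ x, (1 + R * ‖x‖) ^ (2 * k) * ‖trigSeries m x‖ ^ 2 ∂(haarTorus n)
      ≤ 2 ^ (2 * k) * ((1 + n) * (2 * k + 3) ^ n) * A ^ 2 * (R : ℝ) ^ n := by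
  have hR' : (1 : ℝ) ≤ R := by exact_mod_cast hR
  have hfin := finite_support_of_norm hm
  have hfin' : ∀ l, ((dd l)^[k] m).support.Finite := fun l =>
    finite_support_of_norm (N := R + k) fun ξ h => by
      push_cast at h
      exact iterate_dd_eq_zero_of_lt_norm hm l k ξ h
  have hcard : ((latticeBox n (R + k)).card : ℝ) ≤ (2 * k + 3) ^ n * (R : ℝ) ^ n := by
    rw [card_latticeBox, ← mul_pow]
    push_cast
    gcongr
    nlinarith [(Nat.cast_nonneg k : (0 : ℝ) ≤ k)]
  have b0 : ∫ x, ‖trigSeries m x‖ ^ 2 ∂(haarTorus n) ≤ (2 * k + 3) ^ n * (R : ℝ) ^ n * A ^ 2 := by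
    rw [integral_sq_trigSeries (S := latticeBox n (R + k)) fun ξ h => hm ξ (by
      have := lt_norm_of_notMem_latticeBox h
      push_cast at this
      linarith [(Nat.cast_nonneg k : (0 : ℝ) ≤ k)])]
    refine (Finset.sum_le_card_nsmul _ _ (A ^ 2) fun ξ _ => ?_).trans ?_
    · have := h0 ξ
      gcongr
    · rw [nsmul_eq_mul]
      gcongr
  have bl : ∀ l, ∫ x, ‖trigSeries ((dd l)^[k] m) x‖ ^ 2 ∂(haarTorus n)
      ≤ (2 * k + 3) ^ n * (R : ℝ) ^ n * (A / (R : ℝ) ^ k) ^ 2 := by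
    intro l
    rw [integral_sq_trigSeries (S := latticeBox n (R + k)) fun ξ h =>
      iterate_dd_eq_zero_of_lt_norm hm l k ξ (by
        have := lt_norm_of_notMem_latticeBox h
        push_cast at this
        exact this)]
    refine (Finset.sum_le_card_nsmul _ _ ((A / (R : ℝ) ^ k) ^ 2) fun ξ _ => ?_).trans ?_
    · have := hk l ξ
      gcongr
    · rw [nsmul_eq_mul]
      gcongr
  have hc := continuous_trigSeries hfin
  have hc' := fun l => continuous_trigSeries (hfin' l)
  calc ∫ x, (1 + R * ‖x‖) ^ (2 * k) * ‖trigSeries m x‖ ^ 2 ∂(haarTorus n)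
      ≤ ∫ x, 2 ^ (2 * k) * (‖trigSeries m x‖ ^ 2
          + ∑ l, (R : ℝ) ^ (2 * k) * ‖trigSeries ((dd l)^[k] m) x‖ ^ 2) ∂(haarTorus n) := by
        refine integral_mono (integrable_of_continuous (by fun_prop))
          (integrable_of_continuous (by fun_prop)) fun x => ?_
        have h1 := mul_le_mul_of_nonneg_right (one_add_pow_le_sum k (R := R) (by positivity) x)
          (sq_nonneg ‖trigSeries m x‖)
        refine h1.trans ?_
        rw [mul_assoc, add_mul, one_mul, Finset.sum_mul]
        refine mul_le_mul_of_nonneg_left (add_le_add le_rfl (Finset.sum_le_sum fun l _ => ?_))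
          (by positivity)
        rw [mul_assoc]
        refine mul_le_mul_of_nonneg_left ?_ (by positivity)
        rw [trigSeries_iterate_dd hfin, norm_mul, mul_pow, norm_pow, ← pow_mul, mul_comm k 2]
        gcongr
        have := four_mul_norm_le (-(x l))
        rw [norm_neg] at this
        linarith [norm_nonneg (x l)]
    _ = 2 ^ (2 * k) * (∫ x, ‖trigSeries m x‖ ^ 2 ∂(haarTorus n)
          + ∑ l, (R : ℝ) ^ (2 * k) * ∫ x, ‖trigSeries ((dd l)^[k] m) x‖ ^ 2 ∂(haarTorus n)) := by
        rw [integral_const_mul, integral_add (integrable_of_continuous (by fun_prop))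
          (integrable_of_continuous (by fun_prop)), integral_finsetSum _
          fun l _ => integrable_of_continuous (by fun_prop)]
        simp_rw [integral_const_mul]
    _ ≤ 2 ^ (2 * k) * ((2 * k + 3) ^ n * (R : ℝ) ^ n * A ^ 2
          + ∑ l : Fin n, (R : ℝ) ^ (2 * k) *
            ((2 * k + 3) ^ n * (R : ℝ) ^ n * (A / (R : ℝ) ^ k) ^ 2)) := by
        gcongr with l
        exact bl l
    _ = _ := by
        rw [Finset.sum_const, Finset.card_univ, Fintype.card_fin, nsmul_eq_mul, pow_mul' (R : ℝ) 2 k]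
        field_simp

/-- Weighted `L¹` bound for kernels whose symbol is supported at scale `R`. -/
lemma exists_integral_weighted_trigSeries_le {n : ℕ} (hn : 1 ≤ n) {k : ℕ} (hk : n < 2 * k) :
    ∃ C : ℝ, 0 ≤ C ∧ ∀ (R : ℕ) (A : ℝ) (m : (Fin n → ℤ) → ℂ), 1 ≤ R → 0 < A →
      (∀ ξ, (R : ℝ) < ‖ξ‖ → m ξ = 0) → (∀ ξ, ‖m ξ‖ ≤ A) →
      (∀ l ξ, ‖(dd l)^[k] m ξ‖ ≤ A / (R : ℝ) ^ k) →
      ∫ x, (1 + R * ‖x‖) ^ (1 / 4 : ℝ) * ‖trigSeries m x‖ ∂(haarTorus n) ≤ C * A := by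
  have hk' : (n : ℝ) + 1 ≤ 2 * k := by exact_mod_cast hk
  obtain ⟨D, hD0, hD⟩ := exists_integral_decay hn (s := 2 * k - 1 / 2) (by linarith)
  refine ⟨2 ^ (2 * k) * ((1 + n) * (2 * k + 3) ^ n) + D, by positivity,
    fun R A m hR hA hm h0 hkm => ?_⟩
  have hR' : (0 : ℝ) < R := by exact_mod_cast hR
  have hc := continuous_trigSeries (finite_support_of_norm hm)
  have hpos : ∀ x : UnitAddTorus (Fin n), 0 < 1 + R * ‖x‖ := fun x => by positivity
  have hcr : ∀ p : ℝ, Continuous fun x : UnitAddTorus (Fin n) => (1 + R * ‖x‖) ^ p := fun p =>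
    Continuous.rpow_const (by fun_prop) fun x => Or.inl (hpos x).ne'
  have hc1 := hcr (1 / 4)
  have hc2 := hcr (-(2 * k - 1 / 2))
  have hs := integral_weighted_sq_trigSeries_le hR hm h0 hkm
  have hd := hD R hR'
  calc ∫ x, (1 + R * ‖x‖) ^ (1 / 4 : ℝ) * ‖trigSeries m x‖ ∂(haarTorus n)
      ≤ ∫ x, (A⁻¹ * ((R : ℝ) ^ n)⁻¹ * ((1 + R * ‖x‖) ^ (2 * k) * ‖trigSeries m x‖ ^ 2)
          + A * (R : ℝ) ^ n * (1 + R * ‖x‖) ^ (-(2 * k - 1 / 2 : ℝ))) ∂(haarTorus n) := by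
        refine integral_mono (integrable_of_continuous (by fun_prop))
          (integrable_of_continuous (by fun_prop)) fun x => ?_
        dsimp only
        set w := 1 + R * ‖x‖ with hw
        set a := w ^ (1 / 4 - k : ℝ) with ha
        set b := w ^ k * ‖trigSeries m x‖ with hb
        have e1 : w ^ (1 / 4 : ℝ) * ‖trigSeries m x‖ = a * b := by
          rw [ha, hb, ← mul_assoc, ← Real.rpow_natCast w k, ← Real.rpow_add (hpos x)]
          congr 2
          ring
        have e2 : w ^ (-(2 * k - 1 / 2 : ℝ)) = a ^ 2 := by
          rw [ha, ← Real.rpow_natCast, ← Real.rpow_mul (hpos x).le]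
          congr 1
          push_cast
          ring
        have e3 : w ^ (2 * k) * ‖trigSeries m x‖ ^ 2 = b ^ 2 := by
          rw [hb, mul_pow, ← pow_mul, mul_comm k 2]
        rw [e1, e2, e3, ← mul_inv]
        set c := A * (R : ℝ) ^ n with hc
        have hc0 : 0 < c := by positivity
        have h : 0 ≤ c⁻¹ * (b - c * a) ^ 2 := by positivity
        have h' : c⁻¹ * (b - c * a) ^ 2 = c⁻¹ * b ^ 2 + c * a ^ 2 - 2 * (a * b) := by
          field_simp
          ring
        have h3 : 0 ≤ c⁻¹ * b ^ 2 + c * a ^ 2 := by positivity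
        linarith
    _ = A⁻¹ * ((R : ℝ) ^ n)⁻¹ * ∫ x, (1 + R * ‖x‖) ^ (2 * k) * ‖trigSeries m x‖ ^ 2 ∂(haarTorus n)
          + A * (R : ℝ) ^ n * ∫ x, (1 + R * ‖x‖) ^ (-(2 * k - 1 / 2 : ℝ)) ∂(haarTorus n) := by
        rw [integral_add (integrable_of_continuous (by fun_prop))
          (integrable_of_continuous (by fun_prop)), integral_const_mul, integral_const_mul]
    _ ≤ A⁻¹ * ((R : ℝ) ^ n)⁻¹ * (2 ^ (2 * k) * ((1 + n) * (2 * k + 3) ^ n) * A ^ 2 * (R : ℝ) ^ n)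
          + A * (R : ℝ) ^ n * (D / (R : ℝ) ^ n) := by gcongr
    _ = _ := by field_simp

section Cutoff

variable {n : ℕ}

lemma norm_iterate_dd_le_of_contDiff (l : Fin n) (i : ℕ) {g : ℝ → ℝ} (hg : ContDiff ℝ (⊤ : ℕ∞) g)
    {M h : ℝ} (hh : 0 ≤ h) (hM : ∀ t, |iteratedDeriv i g t| ≤ M) {P : (Fin n → ℤ) → ℂ}
    (hP : ∀ ξ, ‖P ξ‖ ≤ 1) (hPl : ∀ ξ, P (ξ + Pi.single l 1) = P ξ) (ξ : Fin n → ℤ) :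
    ‖(dd l)^[i] (fun ξ => (g (h * ξ l) : ℂ) * P ξ) ξ‖ ≤ h ^ i * M := by
  induction i generalizing g M with
  | zero =>
    have h1 := hM (h * ξ l)
    rw [iteratedDeriv_zero] at h1
    simp only [Function.iterate_zero, id_eq, norm_mul, Complex.norm_real, Real.norm_eq_abs,
      pow_zero, one_mul]
    exact (mul_le_of_le_one_right (abs_nonneg _) (hP ξ)).trans h1
  | succ i ih =>
    rw [Function.iterate_succ_apply]
    have e : dd l (fun ξ => (g (h * ξ l) : ℂ) * P ξ)
        = fun ξ => (((fun t => g (t + h) - g t) (h * ξ l) : ℝ) : ℂ) * P ξ := by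
      funext ξ
      simp only [dd, hPl, Pi.add_apply, Pi.single_eq_same]
      push_cast
      rw [mul_add, mul_one]
      ring
    have hg' : ContDiff ℝ (⊤ : ℕ∞) fun t => g (t + h) := hg.comp (contDiff_id.add contDiff_const)
    have hgi : ContDiff ℝ i g := hg.of_le (by exact_mod_cast le_top)
    have hgi' : ContDiff ℝ i fun t => g (t + h) := hg'.of_le (by exact_mod_cast le_top)
    rw [e, pow_succ, mul_assoc]
    refine ih (hg'.sub hg) fun t => ?_
    rw [iteratedDeriv_fun_sub hgi'.contDiffAt hgi.contDiffAt, iteratedDeriv_comp_add_const]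
    have hd : Differentiable ℝ (iteratedDeriv i g) :=
      hg.differentiable_iteratedDeriv i (by exact_mod_cast WithTop.coe_lt_top i)
    have := convex_univ.norm_image_sub_le_of_norm_deriv_le (f := iteratedDeriv i g) (C := M)
      (x := t) (y := t + h) (fun x _ => hd x)
      (fun x _ => by rw [← iteratedDeriv_succ]; exact hM x) (Set.mem_univ _) (Set.mem_univ _)
    simpa [abs_of_nonneg hh, mul_comm] using this

lemma exists_smooth_cutoff (k : ℕ) : ∃ χ : ℝ → ℝ, ContDiff ℝ (⊤ : ℕ∞) χ ∧ (∀ t, |χ t| ≤ 1) ∧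
    (∀ t, |t| ≤ 1 / 2 → χ t = 1) ∧ (∀ t, 1 < |t| → χ t = 0) ∧
    ∃ B : ℝ, 0 < B ∧ ∀ i ≤ k, ∀ t, |iteratedDeriv i χ t| ≤ B := by
  let b : ContDiffBump (0 : ℝ) := ⟨1 / 2, 1, by norm_num, by norm_num⟩
  have hb : ∀ i : ℕ, ∃ C, ∀ t, |iteratedDeriv i b t| ≤ C := fun i => by
    have hc : HasCompactSupport (iteratedFDeriv ℝ i b) := b.hasCompactSupport.iteratedFDeriv i
    have hcont : Continuous (iteratedFDeriv ℝ i b) :=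
      (b.contDiff (n := (⊤ : ℕ∞))).continuous_iteratedFDeriv (by exact_mod_cast le_top)
    obtain ⟨C, hC⟩ := hc.exists_bound_of_continuous hcont
    refine ⟨C, fun t => ?_⟩
    rw [← Real.norm_eq_abs, ← norm_iteratedFDeriv_eq_norm_iteratedDeriv]
    exact hC t
  choose C hC using hb
  refine ⟨b, b.contDiff, fun t => ?_, fun t ht => ?_, fun t ht => ?_, 1 + ∑ i ∈ Finset.range (k + 1), |C i|,
    by positivity, fun i hi t => ?_⟩
  · rw [abs_of_nonneg b.nonneg]
    exact b.le_one
  · exact b.one_of_mem_closedBall (mem_closedBall_zero_iff.2 ht)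
  · exact b.zero_of_le_dist (by simpa using ht.le)
  · have := Finset.single_le_sum (f := fun i => |C i|) (fun i _ => abs_nonneg _)
      (Finset.mem_range_succ_iff.2 hi)
    linarith [hC i t, le_abs_self (C i)]

/-- A family of cutoffs on the lattice, `Φ j` living at frequencies at most `2 ^ j`. -/
structure IsDyadicCutoff (k : ℕ) (B : ℝ) (Φ : ℕ → (Fin n → ℤ) → ℂ) : Prop where
  pos : 0 < B
  eq_one : ∀ j ξ, ‖ξ‖ ≤ 2 ^ j / 2 → Φ j ξ = 1
  eq_zero : ∀ j ξ, 2 ^ j < ‖ξ‖ → Φ j ξ = 0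
  norm_le_one : ∀ j ξ, ‖Φ j ξ‖ ≤ 1
  conj : ∀ j ξ, (starRingEnd ℂ) (Φ j ξ) = Φ j ξ
  norm_iterate_dd_le : ∀ j l ξ, ∀ i ≤ k, ‖(dd l)^[i] (Φ j) ξ‖ ≤ B * ((2 ^ j)⁻¹) ^ i

lemma exists_isDyadicCutoff (n k : ℕ) :
    ∃ (B : ℝ) (Φ : ℕ → (Fin n → ℤ) → ℂ), IsDyadicCutoff k B Φ := by
  obtain ⟨χ, hχ, hχ1, hone, hzero, B, hB0, hB⟩ := exists_smooth_cutoff k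
  have habs : ∀ (j : ℕ) (a : ℤ), |((2 : ℝ) ^ j)⁻¹ * a| = ((2 : ℝ) ^ j)⁻¹ * ‖a‖ := fun j a => by
    rw [abs_mul, abs_of_pos (by positivity), Int.norm_eq_abs]
  refine ⟨B, fun j ξ => ∏ l, (χ ((2 ^ j)⁻¹ * ξ l) : ℂ), hB0, fun j ξ h => ?_, fun j ξ h => ?_,
    fun j ξ => ?_, fun j ξ => ?_, fun j l ξ i hi => ?_⟩
  · refine Finset.prod_eq_one fun l _ => ?_
    rw [hone, Complex.ofReal_one]
    rw [habs, inv_mul_le_iff₀ (by positivity)]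
    have := norm_le_pi_norm ξ l
    linarith
  · obtain ⟨l, hl⟩ : ∃ l, (2 : ℝ) ^ j < ‖ξ l‖ := by
      by_contra! h'
      exact h.not_ge ((pi_norm_le_iff_of_nonneg (by positivity)).2 h')
    refine Finset.prod_eq_zero (Finset.mem_univ l) ?_
    rw [hzero, Complex.ofReal_zero]
    rwa [habs, lt_inv_mul_iff₀ (by positivity), mul_one]
  · rw [norm_prod]
    refine Finset.prod_le_one (fun _ _ => norm_nonneg _) fun l _ => ?_
    simpa using hχ1 _
  · simp [map_prod]
  · have := norm_iterate_dd_le_of_contDiff l i hχ (h := (2 ^ j)⁻¹) (by positivity) (hB i hi)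
      (P := fun ξ => ∏ l' ∈ Finset.univ.erase l, (χ ((2 ^ j)⁻¹ * ξ l') : ℂ)) (fun ξ => ?_)
      (fun ξ => ?_) ξ
    · rw [mul_comm] at this
      convert this using 3
      funext ξ
      exact (Finset.mul_prod_erase _ _ (Finset.mem_univ l)).symm
    · rw [norm_prod]
      refine Finset.prod_le_one (fun _ _ => norm_nonneg _) fun l _ => ?_
      simpa using hχ1 _
    · refine Finset.prod_congr rfl fun l' hl' => ?_
      rw [Pi.add_apply, Pi.single_eq_of_ne (Finset.ne_of_mem_erase hl'), add_zero]

end Cutoff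

section Symbol

variable {n : ℕ}

/-- Symbols of order zero, with pure differences up to order `k` under control. -/
structure IsSymbol (k : ℕ) (C : ℝ) (σ : (Fin n → ℤ) → ℂ) : Prop where
  pos : 0 < C
  norm_le : ∀ ξ, ‖σ ξ‖ ≤ C
  norm_iterate_dd_le : ∀ l ξ, ∀ i ≤ k, ‖(dd l)^[i] σ ξ‖ * (1 + ‖ξ‖) ^ i ≤ C

lemma IsSymbol.conj {k : ℕ} {C : ℝ} {σ : (Fin n → ℤ) → ℂ} (h : IsSymbol k C σ) :
    IsSymbol k C fun ξ => (starRingEnd ℂ) (σ ξ) := by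
  refine ⟨h.pos, fun ξ => ?_, fun l ξ i hi => ?_⟩
  · rw [RCLike.norm_conj]
    exact h.norm_le ξ
  · rw [iterate_dd_conj, RCLike.norm_conj]
    exact h.norm_iterate_dd_le l ξ i hi

lemma foldr_flatMap_replicate_single {α : Type*} (f : Fin n → α → α) (l : Fin n) (i : ℕ)
    (L : List (Fin n)) (hL : L.Nodup) (a : α) :
    (L.flatMap fun j => List.replicate ((Pi.single l i : Fin n → ℕ) j) j).foldr f a
      = if l ∈ L then (f l)^[i] a else a := by
  have hrep : ∀ i : ℕ, ∀ a, (List.replicate i l).foldr f a = (f l)^[i] a := fun i a => by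
    induction i with
    | zero => rfl
    | succ i ih => rw [List.replicate_succ, List.foldr_cons, ih, Function.iterate_succ_apply']
  induction L with
  | nil => simp
  | cons j L ih =>
    rw [List.nodup_cons] at hL
    rw [List.flatMap_cons, List.foldr_append, ih hL.2]
    by_cases h : l = j
    · subst h
      simp [hL.1, hrep]
    · simp [h]

lemma ddM_single (l : Fin n) (i : ℕ) (g : (Fin n → ℤ) → ℂ) :
    ddM (Pi.single l i) g = (dd l)^[i] g := by
  rw [ddM, mIdxList, foldr_flatMap_replicate_single _ _ _ _ (List.nodup_finRange n),
    if_pos (List.mem_finRange l)]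

lemma one_add_norm_le_two_mul_jb (ξ : Fin n → ℤ) : 1 + ‖ξ‖ ≤ 2 * jb ξ := by
  have h1 : 1 ≤ jb ξ := by
    refine Real.one_le_sqrt.2 ?_
    have : 0 ≤ ∑ j, (ξ j : ℝ) ^ 2 := Finset.sum_nonneg fun j _ => sq_nonneg _
    linarith
  have h2 : ‖ξ‖ ≤ jb ξ := by
    refine (pi_norm_le_iff_of_nonneg (by linarith)).2 fun l => ?_
    rw [Int.norm_eq_abs]
    refine Real.abs_le_sqrt ?_
    have := Finset.single_le_sum (f := fun j => (ξ j : ℝ) ^ 2) (fun j _ => sq_nonneg _)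
      (Finset.mem_univ l)
    linarith
  linarith

lemma exists_isSymbol (k : ℕ) (σ : (Fin n → ℤ) → ℂ)
    (hσ : ∀ α : Fin n → ℕ, (∑ j, α j) ≤ k →
      ∃ C : ℝ, 0 < C ∧ ∀ ξ : Fin n → ℤ, ‖ddM α σ ξ‖ ≤ C * jb ξ ^ (-(∑ j, (α j : ℝ)))) :
    ∃ C, IsSymbol k C σ := by
  obtain ⟨C0, hC0, h0⟩ := hσ 0 (by simp)
  have hd0 : ddM 0 σ = σ := by
    have h : mIdxList (0 : Fin n → ℕ) = [] := List.flatMap_eq_nil_iff.2 fun _ _ => rfl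
    rw [ddM, h, List.foldr_nil]
  have hs : ∀ (l : Fin n) (i : ℕ), i ≤ k →
      ∃ C : ℝ, 0 ≤ C ∧ ∀ ξ, ‖(dd l)^[i] σ ξ‖ * (1 + ‖ξ‖) ^ i ≤ C := fun l i hi => by
    obtain ⟨C, hC, h⟩ := hσ (Pi.single l i) (by simpa using hi)
    refine ⟨C * 2 ^ i, by positivity, fun ξ => ?_⟩
    have hx := h ξ
    have hj := one_add_norm_le_two_mul_jb ξ
    have hj0 : 0 < jb ξ := by linarith [norm_nonneg ξ]
    have hsum : ∑ j, ((Pi.single l i : Fin n → ℕ) j : ℝ) = i := by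
      rw [← Nat.cast_sum]
      simp
    rw [ddM_single, hsum, Real.rpow_neg hj0.le, Real.rpow_natCast] at hx
    calc ‖(dd l)^[i] σ ξ‖ * (1 + ‖ξ‖) ^ i ≤ C * (jb ξ ^ i)⁻¹ * (2 * jb ξ) ^ i := by gcongr
      _ = C * 2 ^ i := by
        rw [mul_pow]
        field_simp
  choose! D hD0 hD using hs
  refine ⟨C0 + ∑ l, ∑ i ∈ Finset.range (k + 1), |D l i|, ⟨by positivity, fun ξ => ?_,
    fun l ξ i hi => ?_⟩⟩
  · have := h0 ξ
    rw [hd0] at this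
    simp only [Pi.zero_apply, Nat.cast_zero, Finset.sum_const_zero, neg_zero, Real.rpow_zero,
      mul_one] at this
    have : 0 ≤ ∑ l, ∑ i ∈ Finset.range (k + 1), |D l i| := by positivity
    linarith
  · have h1 := Finset.single_le_sum (f := fun i => |D l i|) (fun i _ => abs_nonneg _)
      (Finset.mem_range_succ_iff.2 hi)
    have h2 := Finset.single_le_sum (f := fun l => ∑ i ∈ Finset.range (k + 1), |D l i|)
      (fun l _ => Finset.sum_nonneg fun i _ => abs_nonneg _) (Finset.mem_univ l)
    linarith [hD l i hi ξ, le_abs_self (D l i)]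

/-- The Littlewood-Paley pieces of a symbol. -/
def dyadicPiece (σ : (Fin n → ℤ) → ℂ) (Φ : ℕ → (Fin n → ℤ) → ℂ) : ℕ → (Fin n → ℤ) → ℂ
  | 0 => fun ξ => σ ξ * Φ 0 ξ
  | j + 1 => fun ξ => σ ξ * (Φ (j + 1) ξ + (-1) * Φ j ξ)

lemma sum_dyadicPiece (σ : (Fin n → ℤ) → ℂ) (Φ : ℕ → (Fin n → ℤ) → ℂ) (N : ℕ) (ξ : Fin n → ℤ) :
    ∑ j ∈ Finset.range (N + 1), dyadicPiece σ Φ j ξ = σ ξ * Φ N ξ := by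
  induction N with
  | zero => simp [dyadicPiece]
  | succ N ih =>
    rw [Finset.sum_range_succ, ih, dyadicPiece]
    ring

lemma dyadicPiece_eq_zero {k : ℕ} {B : ℝ} {σ : (Fin n → ℤ) → ℂ} {Φ : ℕ → (Fin n → ℤ) → ℂ}
    (hΦ : IsDyadicCutoff k B Φ) (j : ℕ) (ξ : Fin n → ℤ) (h : 2 ^ j < ‖ξ‖) :
    dyadicPiece σ Φ j ξ = 0 := by
  cases j with
  | zero => simp only [dyadicPiece, hΦ.eq_zero _ _ h, mul_zero]
  | succ j =>
    have : (2 : ℝ) ^ j < ‖ξ‖ := by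
      rw [pow_succ] at h
      have : (0 : ℝ) < 2 ^ j := by positivity
      linarith
    simp only [dyadicPiece, hΦ.eq_zero _ _ h, hΦ.eq_zero _ _ this, mul_zero, add_zero]

lemma iterate_dd_const_mul (l : Fin n) (i : ℕ) (c : ℂ) (f : (Fin n → ℤ) → ℂ) (ξ : Fin n → ℤ) :
    (dd l)^[i] (fun ξ => c * f ξ) ξ = c * (dd l)^[i] f ξ := by
  induction i generalizing ξ with
  | zero => rfl
  | succ i ih => rw [iterate_dd_succ_apply, iterate_dd_succ_apply, ih, ih, mul_sub]

lemma IsSymbol.norm_iterate_dd_mul_le {k : ℕ} {B C : ℝ} {σ φ : (Fin n → ℤ) → ℂ}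
    (hσ : IsSymbol k C σ) {R c : ℝ} (hR : 0 < R) (hc : 1 ≤ c) (l : Fin n) {i : ℕ} (hi : i ≤ k)
    {ξ : Fin n → ℤ} (hξ : R ≤ c * (1 + ‖ξ‖))
    (hφ : ∀ ξ, ∀ i ≤ k, ‖(dd l)^[i] φ ξ‖ ≤ B * R⁻¹ ^ i) :
    ‖(dd l)^[i] (fun ξ => σ ξ * φ ξ) ξ‖ ≤ C * c ^ k * B * 2 ^ k * R⁻¹ ^ i := by
  have hC := hσ.pos
  have hB : 0 ≤ B := by simpa using (norm_nonneg _).trans (hφ ξ 0 (Nat.zero_le _))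
  have := _root_.norm_iterate_dd_mul_le l i (r := R⁻¹) (ξ := ξ) (f := σ) (g := φ) (A := C * c ^ k)
    (B := B) (fun a ha => ?_) (fun b hb η => hφ η b (hb.trans hi))
  · refine this.trans ?_
    rw [mul_pow, ← mul_assoc]
    gcongr
    norm_num
  · have h1 := hσ.norm_iterate_dd_le l ξ a (ha.trans hi)
    have hx : 0 < 1 + ‖ξ‖ := by positivity
    calc ‖(dd l)^[a] σ ξ‖ = ‖(dd l)^[a] σ ξ‖ * R ^ a * R⁻¹ ^ a := by
          rw [mul_assoc, ← mul_pow, mul_inv_cancel₀ hR.ne', one_pow, mul_one]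
      _ ≤ ‖(dd l)^[a] σ ξ‖ * (c * (1 + ‖ξ‖)) ^ a * R⁻¹ ^ a := by gcongr
      _ = c ^ a * (‖(dd l)^[a] σ ξ‖ * (1 + ‖ξ‖) ^ a) * R⁻¹ ^ a := by
          rw [mul_pow]; ring
      _ ≤ c ^ k * C * R⁻¹ ^ a := by
          gcongr
          exact ha.trans hi
      _ = _ := by ring

lemma norm_iterate_dd_dyadicPiece_le {k : ℕ} {B C : ℝ} {σ : (Fin n → ℤ) → ℂ}
    {Φ : ℕ → (Fin n → ℤ) → ℂ} (hΦ : IsDyadicCutoff k B Φ) (hσ : IsSymbol k C σ) (j : ℕ) (l : Fin n)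
    (ξ : Fin n → ℤ) {i : ℕ} (hi : i ≤ k) :
    ‖(dd l)^[i] (dyadicPiece σ Φ j) ξ‖
      ≤ C * (4 * (1 + k)) ^ k * (B * (1 + 2 ^ k)) * 2 ^ k * ((2 ^ j)⁻¹) ^ i := by
  have hC := hσ.pos
  have hB := hΦ.pos
  have hk0 : (0 : ℝ) ≤ k := Nat.cast_nonneg k
  have hξ0 := norm_nonneg ξ
  cases j with
  | zero =>
    refine hσ.norm_iterate_dd_mul_le (by positivity) (by linarith) l hi ?_ fun ξ i hi => ?_
    · rw [pow_zero]
      nlinarith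
    · refine (hΦ.norm_iterate_dd_le 0 l ξ i hi).trans ?_
      refine mul_le_mul_of_nonneg_right ?_ (by positivity)
      exact le_mul_of_one_le_right hB.le (by linarith [pow_pos (two_pos : (0 : ℝ) < 2) k])
  | succ j =>
    rcases le_or_gt (‖ξ‖ + i) (2 ^ j / 2) with h | h
    · rw [iterate_dd_eq_zero_of_norm_le _ l i ξ h, norm_zero]
      · positivity
      · intro η hη
        have h1 : ‖η‖ ≤ 2 ^ (j + 1) / 2 := hη.trans (by
          rw [pow_succ]
          linarith [pow_pos (two_pos : (0 : ℝ) < 2) j])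
        simp only [dyadicPiece, hΦ.eq_one _ _ hη, hΦ.eq_one _ _ h1]
        ring
    · have hi' : (i : ℝ) ≤ k := by exact_mod_cast hi
      refine hσ.norm_iterate_dd_mul_le (by positivity) (by linarith) l hi ?_ fun ξ i hi => ?_
      · rw [pow_succ]
        nlinarith
      · rw [iterate_dd_add, iterate_dd_const_mul]
        refine (norm_add_le _ _).trans ?_
        have h1 := hΦ.norm_iterate_dd_le (j + 1) l ξ i hi
        have h2 := hΦ.norm_iterate_dd_le j l ξ i hi
        have e : (((2 : ℝ) ^ j)⁻¹) ^ i = 2 ^ i * (((2 : ℝ) ^ (j + 1))⁻¹) ^ i := by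
          rw [← mul_pow, pow_succ]
          congr 1
          field_simp
        have h3 : (2 : ℝ) ^ i ≤ 2 ^ k := pow_le_pow_right₀ (by norm_num) hi
        have h4 : 0 ≤ B * (((2 : ℝ) ^ (j + 1))⁻¹) ^ i := by positivity
        rw [e] at h2
        rw [norm_mul, norm_neg, norm_one, one_mul]
        nlinarith

lemma iterate_dd_mFourier_sub_one (l : Fin n) (i : ℕ) (y : UnitAddTorus (Fin n)) (ξ : Fin n → ℤ) :
    (dd l)^[i + 1] (fun ξ => UnitAddTorus.mFourier ξ y - 1) ξ
      = ((fourier 1 (y l) : ℂ) - 1) ^ (i + 1) * UnitAddTorus.mFourier ξ y := by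
  have h : ∀ ξ, UnitAddTorus.mFourier (ξ + Pi.single l 1) y
      = (fourier 1 (y l) : ℂ) * UnitAddTorus.mFourier ξ y := fun ξ => by
    rw [UnitAddTorus.mFourier_add, UnitAddTorus.mFourier_single, mul_comm]
  induction i generalizing ξ with
  | zero =>
    rw [iterate_dd_succ_apply]
    simp only [Function.iterate_zero, id_eq, h]
    ring
  | succ i ih =>
    rw [iterate_dd_succ_apply, ih, ih, h]
    ring

lemma norm_mFourier_sub_one_le (y : UnitAddTorus (Fin n)) (ξ : Fin n → ℤ) :
    ‖(UnitAddTorus.mFourier ξ y : ℂ) - 1‖ ≤ 2 * π * n * ‖ξ‖ * ‖y‖ := by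
  have h1 : ∀ (a : ℤ) (t : UnitAddCircle), ‖(fourier a t : ℂ) - 1‖ ≤ 2 * π * (‖a‖ * ‖t‖) := by
    intro a t
    have e : (fourier a t : ℂ) = fourier 1 (a • t) := by simp [fourier_apply]
    rw [e]
    refine (norm_fourier_one_sub_one_le _).trans ?_
    have := norm_zsmul_le a t
    rw [Int.norm_eq_abs]
    gcongr
    exact this
  have h2 : ∀ s : Finset (Fin n), ‖(∏ l ∈ s, (fourier (ξ l) (y l) : ℂ)) - 1‖
      ≤ s.card * (2 * π * (‖ξ‖ * ‖y‖)) := by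
    intro s
    induction s using Finset.induction_on with
    | empty => simp
    | insert l s hl ih =>
      rw [Finset.prod_insert hl, Finset.card_insert_of_notMem hl]
      have e : (fourier (ξ l) (y l) : ℂ) * ∏ l ∈ s, (fourier (ξ l) (y l) : ℂ) - 1
          = fourier (ξ l) (y l) * (∏ l ∈ s, (fourier (ξ l) (y l) : ℂ) - 1)
            + ((fourier (ξ l) (y l) : ℂ) - 1) := by ring
      rw [e]
      refine (norm_add_le _ _).trans ?_
      have h3 : ‖(fourier (ξ l) (y l) : ℂ)‖ = 1 := by
        rw [fourier_apply]
        exact Circle.norm_coe _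
      rw [norm_mul, h3, one_mul]
      have h4 := h1 (ξ l) (y l)
      have h5 : 2 * π * (‖ξ l‖ * ‖y l‖) ≤ 2 * π * (‖ξ‖ * ‖y‖) := by
        have := norm_le_pi_norm ξ l
        have := norm_le_pi_norm y l
        gcongr
      push_cast
      linarith
  have := h2 Finset.univ
  rw [Finset.card_univ, Fintype.card_fin] at this
  calc _ ≤ _ := this
    _ = _ := by ring

lemma norm_iterate_dd_mFourier_mul_dyadicPiece_le {k : ℕ} {A : ℝ} (hn : 1 ≤ n) {R : ℝ} (hR : 1 ≤ R)
    {m : (Fin n → ℤ) → ℂ} (hm : ∀ ξ, R < ‖ξ‖ → m ξ = 0) (l : Fin n) (hA : 0 ≤ A)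
    (hk : ∀ ξ, ∀ i ≤ k, ‖(dd l)^[i] m ξ‖ ≤ A * R⁻¹ ^ i) {y : UnitAddTorus (Fin n)}
    (hy : R * ‖y‖ ≤ 1) {i : ℕ} (hi : i ≤ k) (ξ : Fin n → ℤ) :
    ‖(dd l)^[i] (fun ξ => (UnitAddTorus.mFourier ξ y - 1) * m ξ) ξ‖
      ≤ 2 * π * n * (1 + k) * (R * ‖y‖) * A * (4 * π) ^ k * R⁻¹ ^ i := by
  have hR0 : 0 < R := by linarith
  have hpi := Real.pi_gt_three
  have hn' : (1 : ℝ) ≤ n := by exact_mod_cast hn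
  have hk0 : (0 : ℝ) ≤ k := Nat.cast_nonneg k
  rcases lt_or_ge (R + i) ‖ξ‖ with h | h
  · rw [iterate_dd_eq_zero_of_lt_norm (R := R) (fun ξ h => by rw [hm ξ h, mul_zero]) l i ξ h,
      norm_zero]
    positivity
  have hξ : ‖ξ‖ ≤ (1 + k) * R := by
    have : (i : ℝ) ≤ k := by exact_mod_cast hi
    nlinarith
  have := norm_iterate_dd_mul_le l i (r := 2 * π * R⁻¹) (ξ := ξ)
    (f := fun ξ => UnitAddTorus.mFourier ξ y - 1) (g := m)
    (A := 2 * π * n * (1 + k) * (R * ‖y‖)) (B := A) (fun a ha => ?_) (fun b hb η => ?_)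
  · refine this.trans ?_
    rw [show 2 * (2 * π * R⁻¹) = (4 * π) * R⁻¹ by ring, mul_pow, ← mul_assoc]
    gcongr
    linarith
  · cases a with
    | zero =>
      simp only [Function.iterate_zero, id_eq, pow_zero, mul_one]
      calc _ ≤ _ := norm_mFourier_sub_one_le y ξ
        _ ≤ 2 * π * n * ((1 + k) * R) * ‖y‖ := by gcongr
        _ = _ := by ring
    | succ a =>
      have h1 := norm_fourier_one_sub_one_le (y l)
      have h2 := norm_le_pi_norm y l
      have h3 : (R * ‖y‖) ^ (a + 1) ≤ R * ‖y‖ := by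
        rw [pow_succ]
        exact mul_le_of_le_one_left (by positivity) (pow_le_one₀ (by positivity) hy)
      rw [iterate_dd_mFourier_sub_one, norm_mul, norm_pow, norm_mFourier_apply, mul_one]
      calc ‖(fourier 1 (y l) : ℂ) - 1‖ ^ (a + 1) ≤ (2 * π * ‖y‖) ^ (a + 1) := by
            gcongr
            exact h1.trans (by gcongr)
        _ = (R * ‖y‖) ^ (a + 1) * (2 * π * R⁻¹) ^ (a + 1) := by
            rw [← mul_pow]
            congr 1
            field_simp
        _ ≤ (2 * π * n * (1 + k) * (R * ‖y‖)) * (2 * π * R⁻¹) ^ (a + 1) := by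
            gcongr
            refine h3.trans (le_mul_of_one_le_left (by positivity) ?_)
            nlinarith [mul_nonneg pi_pos.le hk0]
  · refine (hk η b (hb.trans hi)).trans ?_
    gcongr
    exact le_mul_of_one_le_left (by positivity) (by linarith)

end Symbol

section Hormander

variable {n : ℕ}

lemma sum_le_of_geometric {q M : ℝ} (hq0 : 0 ≤ q) (hq1 : q < 1) (hM : 0 ≤ M) (i N : ℕ) {a : ℕ → ℝ}
    (h1 : ∀ d, a (i + d) ≤ M * q ^ d) (h2 : ∀ j < i, a j ≤ M * q ^ (i - j)) :
    ∑ j ∈ Finset.range N, a j ≤ 2 * M * (1 - q)⁻¹ := by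
  have hgeom : ∀ L, ∑ d ∈ Finset.range L, q ^ d ≤ (1 - q)⁻¹ := fun L => by
    rw [← tsum_geometric_of_lt_one hq0 hq1]
    exact (summable_geometric_of_lt_one hq0 hq1).sum_le_tsum _ fun d _ => by positivity
  rw [← Finset.sum_filter_add_sum_filter_not (Finset.range N) (· < i)]
  have e1 : ∑ j ∈ Finset.range N with j < i, a j ≤ M * (1 - q)⁻¹ := by
    calc ∑ j ∈ Finset.range N with j < i, a j
        ≤ ∑ j ∈ Finset.range N with j < i, M * q ^ (i - j) :=
          Finset.sum_le_sum fun j hj => h2 j (Finset.mem_filter.1 hj).2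
      _ ≤ ∑ j ∈ Finset.range i, M * q ^ (i - j) :=
          Finset.sum_le_sum_of_subset_of_nonneg
            (fun j hj => Finset.mem_range.2 (Finset.mem_filter.1 hj).2) fun _ _ _ => by positivity
      _ = M * ∑ j ∈ Finset.range i, q ^ (j + 1) := by
          rw [← Finset.mul_sum, ← Finset.sum_range_reflect (fun j => q ^ (j + 1))]
          congr 1
          refine Finset.sum_congr rfl fun j hj => ?_
          congr 1
          have := Finset.mem_range.1 hj
          omega
      _ ≤ M * ∑ j ∈ Finset.range i, q ^ j := by
          gcongr M * ∑ j ∈ Finset.range i, ?_ with j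
          exact pow_le_pow_of_le_one hq0 hq1.le (Nat.le_succ j)
      _ ≤ _ := by
          gcongr
          exact hgeom i
  have e2 : ∑ j ∈ Finset.range N with ¬ j < i, a j ≤ M * (1 - q)⁻¹ := by
    have : (Finset.range N).filter (fun j => ¬ j < i) = Finset.Ico i N := by
      ext j
      simp
      omega
    rw [this, Finset.sum_Ico_eq_sum_range]
    calc ∑ d ∈ Finset.range (N - i), a (i + d) ≤ ∑ d ∈ Finset.range (N - i), M * q ^ d :=
          Finset.sum_le_sum fun d _ => h1 d
      _ = M * ∑ d ∈ Finset.range (N - i), q ^ d := by rw [Finset.mul_sum]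
      _ ≤ _ := by
          gcongr
          exact hgeom _
  linarith

lemma trigSeries_sub_sub {m : (Fin n → ℤ) → ℂ} (hm : m.support.Finite)
    (x y : UnitAddTorus (Fin n)) :
    trigSeries m (x - y) - trigSeries m x
      = trigSeries (fun ξ => (UnitAddTorus.mFourier ξ (-y) - 1) * m ξ) x := by
  obtain ⟨S, hS⟩ := exists_finset_of_support hm
  rw [trigSeries_eq_sum hS, trigSeries_eq_sum hS,
    trigSeries_eq_sum (S := S) fun ξ h => by rw [hS ξ h, mul_zero], ← Finset.sum_sub_distrib]
  refine Finset.sum_congr rfl fun ξ _ => ?_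
  rw [sub_eq_add_neg x, mFourier_add_apply]
  ring

lemma trigSeries_sum {ι : Type*} (s : Finset ι) {m : ι → (Fin n → ℤ) → ℂ}
    (hm : ∀ j, (m j).support.Finite) (x : UnitAddTorus (Fin n)) :
    trigSeries (fun ξ => ∑ j ∈ s, m j ξ) x = ∑ j ∈ s, trigSeries (m j) x := by
  unfold trigSeries
  rw [← Summable.tsum_finsetSum fun j _ => summable_of_hasFiniteSupport (finite_support_mul (hm j) _)]
  simp_rw [Finset.sum_mul]

lemma setIntegral_sub_le_of_weight {K : UnitAddTorus (Fin n) → ℂ} (hK : Continuous K) {R δ D : ℝ}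
    (hR : 0 < R) (hδ : 0 < δ)
    (hD : ∫ x, (1 + R * ‖x‖) ^ (1 / 4 : ℝ) * ‖K x‖ ∂(haarTorus n) ≤ D)
    {y : UnitAddTorus (Fin n)} (hy : ‖y‖ ≤ δ) :
    (R * δ) ^ (1 / 4 : ℝ) * ∫ x in {x | 2 * δ < ‖x‖}, ‖K (x - y) - K x‖ ∂(haarTorus n) ≤ 2 * D := by
  have hmeas : MeasurableSet {x : UnitAddTorus (Fin n) | 2 * δ < ‖x‖} :=
    (isOpen_lt continuous_const continuous_norm).measurableSet
  have hcw : Continuous fun x : UnitAddTorus (Fin n) => (1 + R * ‖x‖) ^ (1 / 4 : ℝ) * ‖K x‖ :=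
    (Continuous.rpow_const (by fun_prop) fun x => Or.inr (by norm_num)).mul hK.norm
  set W : UnitAddTorus (Fin n) → ℝ := fun x => (1 + R * ‖x‖) ^ (1 / 4 : ℝ) * ‖K x‖ with hW
  have hW0 : ∀ x, 0 ≤ W x := fun x => by positivity
  have hcW : Continuous fun x => W (x - y) + W x := by fun_prop
  have hKint : Continuous fun x => ‖K (x - y) - K x‖ := by fun_prop
  rw [← integral_const_mul]
  calc ∫ x in {x | 2 * δ < ‖x‖}, (R * δ) ^ (1 / 4 : ℝ) * ‖K (x - y) - K x‖ ∂(haarTorus n)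
      ≤ ∫ x in {x | 2 * δ < ‖x‖}, (W (x - y) + W x) ∂(haarTorus n) := by
        refine setIntegral_mono_on (integrable_of_continuous (by fun_prop)).integrableOn
          (integrable_of_continuous hcW).integrableOn hmeas fun x hx => ?_
        have hx : 2 * δ < ‖x‖ := hx
        have key : ∀ z : UnitAddTorus (Fin n), δ ≤ ‖z‖ → (R * δ) ^ (1 / 4 : ℝ) * ‖K z‖ ≤ W z := by
          intro z hz
          refine mul_le_mul_of_nonneg_right ?_ (norm_nonneg _)
          refine Real.rpow_le_rpow (by positivity) ?_ (by norm_num)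
          nlinarith
        have h1 := key (x - y) (by linarith [norm_sub_norm_le x y])
        have h2 := key x (by linarith)
        have h3 : 0 ≤ (R * δ) ^ (1 / 4 : ℝ) := by positivity
        nlinarith [norm_sub_le (K (x - y)) (K x)]
    _ ≤ ∫ x, (W (x - y) + W x) ∂(haarTorus n) :=
        setIntegral_le_integral (integrable_of_continuous hcW)
          (.of_forall fun x => add_nonneg (hW0 _) (hW0 _))
    _ = 2 * ∫ x, W x ∂(haarTorus n) := by
        rw [integral_add (integrable_of_continuous (by fun_prop)) (integrable_of_continuous hcw),
          integral_sub_right_eq_self W y]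
        ring
    _ ≤ _ := by linarith

/-- The Hörmander regularity condition for the kernels of truncated symbols. -/
lemma exists_hormander (hn : 1 ≤ n) {k : ℕ} (hk : n < 2 * k) (B C : ℝ) :
    ∃ H : ℝ, 0 < H ∧ ∀ (σ : (Fin n → ℤ) → ℂ) (Φ : ℕ → (Fin n → ℤ) → ℂ), IsSymbol k C σ →
      IsDyadicCutoff k B Φ → ∀ (N i : ℕ) (y : UnitAddTorus (Fin n)), ‖y‖ ≤ (2 ^ i)⁻¹ →
      ∫ x in {x | 2 * (2 ^ i)⁻¹ < ‖x‖}, ‖trigSeries (fun ξ => σ ξ * Φ N ξ) (x - y)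
        - trigSeries (fun ξ => σ ξ * Φ N ξ) x‖ ∂(haarTorus n) ≤ H := by
  obtain ⟨D, hD0, hD⟩ := exists_integral_weighted_trigSeries_le hn hk
  have hpi := pi_pos
  set A : ℝ := C * (4 * (1 + k)) ^ k * (B * (1 + 2 ^ k)) * 2 ^ k with hA
  set E : ℝ := 2 * π * n * (1 + k) * A * (4 * π) ^ k with hE
  set q : ℝ := 2⁻¹ ^ (1 / 4 : ℝ) with hq
  have hq0 : 0 < q := by positivity
  have hq1 : q < 1 := Real.rpow_lt_one (by norm_num) (by norm_num) (by norm_num)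
  refine ⟨2 * (|D * E| + |2 * (D * A)|) * (1 - q)⁻¹ + 1, ?_,
    fun σ Φ hσ hΦ N i y hy => ?_⟩
  · have : 0 < 1 - q := by linarith
    positivity
  have hC := hσ.pos
  have hB := hΦ.pos
  have hA0 : 0 < A := by positivity
  have hn0 : (0 : ℝ) < n := by exact_mod_cast hn
  set m := dyadicPiece σ Φ with hm
  have hsupp : ∀ j, ∀ ξ, (2 : ℝ) ^ j < ‖ξ‖ → m j ξ = 0 := fun j ξ h => dyadicPiece_eq_zero hΦ j ξ h
  have hfin : ∀ j, (m j).support.Finite := fun j =>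
    finite_support_of_norm (N := 2 ^ j) fun ξ h => hsupp j ξ (by exact_mod_cast h)
  have hcont := fun j => continuous_trigSeries (hfin j)
  have hbd : ∀ j l ξ, ∀ i ≤ k, ‖(dd l)^[i] (m j) ξ‖ ≤ A * ((2 ^ j)⁻¹) ^ i := fun j l ξ i hi =>
    norm_iterate_dd_dyadicPiece_le hΦ hσ j l ξ hi
  let l0 : Fin n := ⟨0, hn⟩
  have hweight : ∀ j, ∫ x, (1 + 2 ^ j * ‖x‖) ^ (1 / 4 : ℝ) * ‖trigSeries (m j) x‖ ∂(haarTorus n)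
      ≤ D * A := fun j => by
    have := hD (2 ^ j) A (m j) Nat.one_le_two_pow hA0 (by exact_mod_cast hsupp j)
      (fun ξ => by simpa using hbd j l0 ξ 0 (Nat.zero_le _))
      (fun l ξ => by simpa [div_eq_mul_inv] using hbd j l ξ k le_rfl)
    exact_mod_cast this
  have hKsum : ∀ x, trigSeries (fun ξ => σ ξ * Φ N ξ) x
      = ∑ j ∈ Finset.range (N + 1), trigSeries (m j) x := fun x => by
    rw [← trigSeries_sum _ hfin]
    simp_rw [hm, sum_dyadicPiece]
  set S : Set (UnitAddTorus (Fin n)) := {x | 2 * (2 ^ i)⁻¹ < ‖x‖} with hS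
  have hdc : ∀ j, Continuous fun x => ‖trigSeries (m j) (x - y) - trigSeries (m j) x‖ := fun j => by
    have := hcont j
    fun_prop
  calc ∫ x in S, ‖trigSeries (fun ξ => σ ξ * Φ N ξ) (x - y)
        - trigSeries (fun ξ => σ ξ * Φ N ξ) x‖ ∂(haarTorus n)
      ≤ ∫ x in S, ∑ j ∈ Finset.range (N + 1),
          ‖trigSeries (m j) (x - y) - trigSeries (m j) x‖ ∂(haarTorus n) := by
        simp_rw [hKsum, ← Finset.sum_sub_distrib]
        refine integral_mono (integrable_of_continuous ?_).integrableOn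
          (integrable_of_continuous (by fun_prop)).integrableOn fun x => norm_sum_le _ _
        fun_prop
    _ = ∑ j ∈ Finset.range (N + 1),
          ∫ x in S, ‖trigSeries (m j) (x - y) - trigSeries (m j) x‖ ∂(haarTorus n) :=
        integral_finsetSum _ fun j _ => (integrable_of_continuous (hdc j)).integrableOn
    _ ≤ 2 * (|D * E| + |2 * (D * A)|) * (1 - q)⁻¹ := by
        refine sum_le_of_geometric hq0.le hq1 (by positivity) i _ (fun d => ?_) fun j hj => ?_
        · have h := setIntegral_sub_le_of_weight (hcont (i + d)) (R := 2 ^ (i + d)) (by positivity)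
            (by positivity) (hweight (i + d)) hy
          have e : ((2 : ℝ) ^ (i + d) * (2 ^ i)⁻¹) ^ (1 / 4 : ℝ) = (q ^ d)⁻¹ := by
            rw [pow_add, mul_comm, ← mul_assoc, inv_mul_cancel₀ (by positivity), one_mul, hq,
              Real.inv_rpow (by norm_num), inv_pow, inv_inv, ← Real.rpow_natCast, ← Real.rpow_natCast,
              ← Real.rpow_mul (by norm_num), ← Real.rpow_mul (by norm_num), mul_comm]
          rw [e, inv_mul_le_iff₀ (by positivity)] at h
          refine h.trans ?_
          rw [mul_comm]
          gcongr
          linarith [le_abs_self (2 * (D * A)), abs_nonneg (D * E)]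
        · obtain ⟨d, rfl⟩ : ∃ d, i = j + d := ⟨i - j, by omega⟩
          rw [Nat.add_sub_cancel_left]
          have hRy : (2 : ℝ) ^ j * ‖y‖ ≤ 2⁻¹ ^ d := by
            calc (2 : ℝ) ^ j * ‖y‖ ≤ 2 ^ j * (2 ^ (j + d))⁻¹ := by gcongr
              _ = _ := by
                rw [pow_add, mul_inv, ← mul_assoc, mul_inv_cancel₀ (by positivity), one_mul, inv_pow]
          have h12 : (2 : ℝ)⁻¹ ^ d ≤ q ^ d := by
            gcongr
            rw [hq]
            calc (2 : ℝ)⁻¹ = 2⁻¹ ^ (1 : ℝ) := (Real.rpow_one _).symm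
              _ ≤ _ := Real.rpow_le_rpow_of_exponent_ge (by norm_num) (by norm_num) (by norm_num)
          have hRy1 : (2 : ℝ) ^ j * ‖-y‖ ≤ 1 := by
            rw [norm_neg]
            exact hRy.trans (pow_le_one₀ (by norm_num) (by norm_num))
          have hb := fun l ξ i (hi : i ≤ k) =>
            norm_iterate_dd_mFourier_mul_dyadicPiece_le hn (one_le_pow₀ one_le_two) (hsupp j) l hA0.le
              (fun ξ i hi => hbd j l ξ i hi) hRy1 hi ξ
          set A' := E * (2 : ℝ)⁻¹ ^ d with hA'
          have hE0 : 0 < E := by positivity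
          have hAle : 2 * π * n * (1 + k) * (2 ^ j * ‖-y‖) * A * (4 * π) ^ k ≤ A' := by
            rw [norm_neg]
            calc _ = E * (2 ^ j * ‖y‖) := by
                  rw [hE]
                  ring
              _ ≤ _ := by
                  rw [hA']
                  gcongr
          have h := hD (2 ^ j) A' (fun ξ => (UnitAddTorus.mFourier ξ (-y) - 1) * m j ξ)
            Nat.one_le_two_pow (by positivity)
            (fun ξ h => by rw [hsupp j ξ (by exact_mod_cast h), mul_zero])
            (fun ξ => by
              have := hb l0 ξ 0 (Nat.zero_le _)
              rw [pow_zero, mul_one] at this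
              exact this.trans hAle)
            (fun l ξ => by
              refine (hb l ξ k le_rfl).trans ?_
              rw [div_eq_mul_inv, inv_pow]
              push_cast
              gcongr)
          calc ∫ x in S, ‖trigSeries (m j) (x - y) - trigSeries (m j) x‖ ∂(haarTorus n)
              ≤ ∫ x, ‖trigSeries (m j) (x - y) - trigSeries (m j) x‖ ∂(haarTorus n) :=
                setIntegral_le_integral (integrable_of_continuous (hdc j))
                  (.of_forall fun x => norm_nonneg _)
            _ ≤ ∫ x, (1 + (2 ^ j : ℕ) * ‖x‖) ^ (1 / 4 : ℝ)
                  * ‖trigSeries (fun ξ => (UnitAddTorus.mFourier ξ (-y) - 1) * m j ξ) x‖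
                  ∂(haarTorus n) := by
                have hc2 : Continuous fun x : UnitAddTorus (Fin n) =>
                    (1 + (2 ^ j : ℕ) * ‖x‖) ^ (1 / 4 : ℝ) :=
                  Continuous.rpow_const (by fun_prop) fun x => Or.inr (by norm_num)
                simp_rw [← trigSeries_sub_sub (hfin j)]
                refine integral_mono (integrable_of_continuous (hdc j))
                  (integrable_of_continuous (hc2.mul (hdc j))) fun x => ?_
                refine le_mul_of_one_le_left (norm_nonneg _) ?_
                refine Real.one_le_rpow ?_ (by norm_num)
                have : 0 ≤ ((2 ^ j : ℕ) : ℝ) * ‖x‖ := by positivity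
                linarith
            _ ≤ D * A' := h
            _ = D * E * (2 : ℝ)⁻¹ ^ d := (mul_assoc _ _ _).symm
            _ ≤ (|D * E| + |2 * (D * A)|) * q ^ d := by
                gcongr
                linarith [le_abs_self (D * E), abs_nonneg (2 * (D * A))]
    _ ≤ _ := by linarith

end Hormander

section Cells

variable {n : ℕ}

/-- The index of the dyadic cell of side `2⁻ʲ` containing `x`. -/
def dyadicIndex (j : ℕ) (x : UnitAddTorus (Fin n)) : Fin n → ℤ :=
  fun l => ⌈(2 : ℝ) ^ j * (AddCircle.equivIoc (1 : ℝ) 0 (x l) : ℝ)⌉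

/-- The dyadic cell of side `2⁻ʲ` with index `c`. -/
def dyadicCell (j : ℕ) (c : Fin n → ℤ) : Set (UnitAddTorus (Fin n)) := {x | dyadicIndex j x = c}

lemma mem_dyadicCell {j : ℕ} {c : Fin n → ℤ} {x : UnitAddTorus (Fin n)} :
    x ∈ dyadicCell j c ↔ dyadicIndex j x = c := Iff.rfl

lemma measurable_equivIoc_coe :
    Measurable fun t : UnitAddCircle => (AddCircle.equivIoc (1 : ℝ) 0 t : ℝ) :=
  measurable_subtype_coe.comp (AddCircle.measurableEquivIoc (1 : ℝ) 0).measurable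

lemma measurable_dyadicIndex (j : ℕ) :
    Measurable (dyadicIndex j : UnitAddTorus (Fin n) → Fin n → ℤ) := by
  refine measurable_pi_lambda _ fun l => Int.measurable_ceil.comp ?_
  exact (measurable_equivIoc_coe.comp (measurable_pi_apply l)).const_mul _

lemma measurableSet_dyadicCell (j : ℕ) (c : Fin n → ℤ) : MeasurableSet (dyadicCell j c) :=
  measurable_dyadicIndex j (measurableSet_singleton c)

lemma dyadicIndex_pos (j : ℕ) (x : UnitAddTorus (Fin n)) (l : Fin n) : 1 ≤ dyadicIndex j x l := by
  have h := (AddCircle.equivIoc (1 : ℝ) 0 (x l)).2.1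
  exact Int.one_le_ceil_iff.2 (by positivity)

lemma dyadicIndex_le (j : ℕ) (x : UnitAddTorus (Fin n)) (l : Fin n) :
    dyadicIndex j x l ≤ 2 ^ j := by
  have h := (AddCircle.equivIoc (1 : ℝ) 0 (x l)).2.2.trans_eq (zero_add 1)
  refine Int.ceil_le.2 ?_
  push_cast
  exact mul_le_of_le_one_right (by positivity) h

lemma ceil_two_pow_mul_le {i j : ℕ} (hij : i ≤ j) {a b : ℝ}
    (h : ⌈(2 : ℝ) ^ j * a⌉ ≤ ⌈(2 : ℝ) ^ j * b⌉) : ⌈(2 : ℝ) ^ i * a⌉ ≤ ⌈(2 : ℝ) ^ i * b⌉ := by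
  have e : (2 : ℝ) ^ j = 2 ^ (j - i) * 2 ^ i := by rw [← pow_add, Nat.sub_add_cancel hij]
  have h1 : ⌈(2 : ℝ) ^ j * b⌉ ≤ 2 ^ (j - i) * ⌈(2 : ℝ) ^ i * b⌉ := by
    refine Int.ceil_le.2 ?_
    push_cast
    rw [e, mul_assoc]
    exact mul_le_mul_of_nonneg_left (Int.le_ceil _) (by positivity)
  have h2 := Int.ceil_le.1 (h.trans h1)
  push_cast at h2
  rw [e, mul_assoc] at h2
  exact Int.ceil_le.2 (le_of_mul_le_mul_left h2 (by positivity))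

lemma dyadicIndex_eq_of_le {i j : ℕ} (hij : i ≤ j) {x y : UnitAddTorus (Fin n)}
    (h : dyadicIndex j x = dyadicIndex j y) : dyadicIndex i x = dyadicIndex i y := by
  funext l
  have hl := congrFun h l
  exact le_antisymm (ceil_two_pow_mul_le hij hl.le) (ceil_two_pow_mul_le hij hl.ge)

lemma UnitAddCircle.norm_coe_le (r : ℝ) : ‖(r : UnitAddCircle)‖ ≤ |r| := by
  rw [UnitAddCircle.norm_eq]
  simpa using round_le r 0

lemma norm_sub_le_of_dyadicIndex_eq {j : ℕ} {x y : UnitAddTorus (Fin n)}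
    (h : dyadicIndex j x = dyadicIndex j y) : ‖x - y‖ ≤ ((2 : ℝ) ^ j)⁻¹ := by
  refine (pi_norm_le_iff_of_nonneg (by positivity)).2 fun l => ?_
  have hl := congrFun h l
  unfold dyadicIndex at hl
  set a := (AddCircle.equivIoc (1 : ℝ) 0 (x l) : ℝ) with ha
  set b := (AddCircle.equivIoc (1 : ℝ) 0 (y l) : ℝ) with hb
  have e : (x - y) l = ((a - b : ℝ) : UnitAddCircle) := by
    rw [AddCircle.coe_sub, ha, hb, AddCircle.coe_equivIoc, AddCircle.coe_equivIoc, Pi.sub_apply]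
  rw [e]
  refine (UnitAddCircle.norm_coe_le _).trans ?_
  have h2 : (0 : ℝ) < 2 ^ j := by positivity
  have h3 : |(2 : ℝ) ^ j * (a - b)| ≤ 1 := by
    have a1 := Int.le_ceil ((2 : ℝ) ^ j * a)
    have a2 := Int.ceil_lt_add_one ((2 : ℝ) ^ j * a)
    have b1 := Int.le_ceil ((2 : ℝ) ^ j * b)
    have b2 := Int.ceil_lt_add_one ((2 : ℝ) ^ j * b)
    rw [hl] at a1 a2
    rw [abs_le]
    constructor <;> linarith
  rw [abs_mul, abs_of_pos h2] at h3
  rw [← one_div, le_div_iff₀ h2]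
  linarith

lemma volume_ceil_eq {j : ℕ} {c : ℤ} (h1 : 1 ≤ c) (h2 : c ≤ 2 ^ j) :
    (volume : Measure UnitAddCircle)
      {t | ⌈(2 : ℝ) ^ j * (AddCircle.equivIoc (1 : ℝ) 0 t : ℝ)⌉ = c}
      = ENNReal.ofReal ((2 : ℝ) ^ j)⁻¹ := by
  have hj : (0 : ℝ) < 2 ^ j := by positivity
  have h1' : (1 : ℝ) ≤ c := by exact_mod_cast h1
  have h2' : (c : ℝ) ≤ 2 ^ j := by exact_mod_cast h2
  set s : Set (Set.Ioc (0 : ℝ) (0 + 1)) := {r | ⌈(2 : ℝ) ^ j * (r : ℝ)⌉ = c} with hs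
  have hsm : MeasurableSet s := by
    have : Measurable fun r : Set.Ioc (0 : ℝ) (0 + 1) => ⌈(2 : ℝ) ^ j * (r : ℝ)⌉ :=
      Int.measurable_ceil.comp (measurable_subtype_coe.const_mul _)
    exact this (measurableSet_singleton c)
  have h := (AddCircle.measurePreserving_equivIoc (1 : ℝ) (a := 0)).measure_preimage
    hsm.nullMeasurableSet
  have e : (AddCircle.equivIoc (1 : ℝ) 0) ⁻¹' s
      = {t | ⌈(2 : ℝ) ^ j * (AddCircle.equivIoc (1 : ℝ) 0 t : ℝ)⌉ = c} := rfl
  rw [← e]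
  refine h.trans ?_
  rw [comap_subtype_coe_apply measurableSet_Ioc]
  have e2 : (Subtype.val '' s) = Set.Ioc ((c - 1) / (2 : ℝ) ^ j) (c / 2 ^ j) := by
    ext r
    rw [Set.mem_Ioc, div_lt_iff₀ hj, le_div_iff₀ hj, mul_comm r]
    constructor
    · rintro ⟨⟨r, hr⟩, h, rfl⟩
      exact Int.ceil_eq_iff.1 h
    · rintro ⟨ha, hb⟩
      refine ⟨⟨r, ?_, ?_⟩, Int.ceil_eq_iff.2 ⟨ha, hb⟩, rfl⟩
      · exact pos_of_mul_pos_right (lt_of_le_of_lt (by linarith) ha) hj.le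
      · rw [zero_add]
        exact le_of_mul_le_mul_left (by linarith) hj
  rw [e2, Real.volume_Ioc]
  congr 1
  field_simp
  ring

lemma haarTorus_dyadicCell (j : ℕ) (x : UnitAddTorus (Fin n)) :
    haarTorus n (dyadicCell j (dyadicIndex j x)) = ENNReal.ofReal (((2 : ℝ) ^ j)⁻¹ ^ n) := by
  have e : dyadicCell j (dyadicIndex j x) = Set.univ.pi fun l =>
      {t : UnitAddCircle | ⌈(2 : ℝ) ^ j * (AddCircle.equivIoc (1 : ℝ) 0 t : ℝ)⌉
        = dyadicIndex j x l} := by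
    ext y
    simp [mem_dyadicCell, funext_iff, dyadicIndex]
  rw [e, haarTorus, Measure.pi_pi, haarAddCircle_eq_volume]
  simp_rw [volume_ceil_eq (dyadicIndex_pos j x _) (dyadicIndex_le j x _)]
  rw [Finset.prod_const, Finset.card_univ, Fintype.card_fin, ENNReal.ofReal_pow (by positivity)]

lemma haarTorus_real_dyadicCell (j : ℕ) (x : UnitAddTorus (Fin n)) :
    (haarTorus n).real (dyadicCell j (dyadicIndex j x)) = ((2 : ℝ) ^ j)⁻¹ ^ n := by
  rw [Measure.real, haarTorus_dyadicCell, ENNReal.toReal_ofReal (by positivity)]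

lemma setIntegral_norm_dyadicCell_mono {f : UnitAddTorus (Fin n) → ℂ}
    (hf : Integrable f (haarTorus n)) {i j : ℕ} (hij : i ≤ j) (x : UnitAddTorus (Fin n)) :
    ∫ t in dyadicCell j (dyadicIndex j x), ‖f t‖ ∂haarTorus n
      ≤ ∫ t in dyadicCell i (dyadicIndex i x), ‖f t‖ ∂haarTorus n :=
  setIntegral_mono_set hf.norm.integrableOn (.of_forall fun _ => norm_nonneg _)
    (.of_forall fun _ hy => dyadicIndex_eq_of_le hij hy)

/-- The stopping-time family of dyadic cells of a continuous function at height `L`. -/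
lemma exists_stopping_cells {f : UnitAddTorus (Fin n) → ℂ} (hf : Continuous f) {L : ℝ} (hL : 0 < L)
    (hfL : ∫ x, ‖f x‖ ∂haarTorus n ≤ L) :
    ∃ S : Finset (ℕ × (Fin n → ℤ)),
      (∀ q ∈ S, (∃ y, dyadicIndex q.1 y = q.2) ∧
        L * ((2 : ℝ) ^ q.1)⁻¹ ^ n < ∫ x in dyadicCell q.1 q.2, ‖f x‖ ∂haarTorus n ∧
        ∫ x in dyadicCell q.1 q.2, ‖f x‖ ∂haarTorus n ≤ 2 ^ n * L * ((2 : ℝ) ^ q.1)⁻¹ ^ n) ∧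
      (S : Set (ℕ × (Fin n → ℤ))).PairwiseDisjoint (fun q => dyadicCell q.1 q.2) ∧
      ∀ x, (∀ q ∈ S, x ∉ dyadicCell q.1 q.2) → ‖f x‖ ≤ 2 * L := by
  classical
  have hfi : Integrable f (haarTorus n) := integrable_of_continuous hf
  obtain ⟨δ, hδ, hδf⟩ := Metric.uniformContinuous_iff.1
    (CompactSpace.uniformContinuous_of_continuous hf) L hL
  obtain ⟨J, hJ⟩ := exists_pow_lt_of_lt_one hδ (by norm_num : (2 : ℝ)⁻¹ < 1)
  rw [inv_pow] at hJ
  let I : ℕ → UnitAddTorus (Fin n) → ℝ := fun j x =>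
    ∫ t in dyadicCell j (dyadicIndex j x), ‖f t‖ ∂haarTorus n
  let v : ℕ → ℝ := fun j => ((2 : ℝ) ^ j)⁻¹ ^ n
  have hv : ∀ j, 0 < v j := fun j => by positivity
  let good : ℕ → UnitAddTorus (Fin n) → Prop := fun j x => L * v j < I j x ∧ ∀ i < j, I i x ≤ L * v i
  have hIeq : ∀ {i j x y}, i ≤ j → dyadicIndex j x = dyadicIndex j y → I i x = I i y :=
    fun hij h => by simp only [I, dyadicIndex_eq_of_le hij h]
  have hgood : ∀ {j x y}, dyadicIndex j x = dyadicIndex j y → good j x → good j y := by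
    rintro j x y h ⟨h1, h2⟩
    exact ⟨hIeq le_rfl h ▸ h1, fun i hi => hIeq hi.le h ▸ h2 i hi⟩
  let Z : Set (ℕ × (Fin n → ℤ)) := {q | q.1 ≤ J ∧ ∃ y, dyadicIndex q.1 y = q.2 ∧ good q.1 y}
  have hZ : Z.Finite := by
    refine (Finset.finite_toSet
      (Finset.range (J + 1) ×ˢ Fintype.piFinset fun _ : Fin n => Finset.Icc (1 : ℤ) (2 ^ J))).subset ?_
    rintro ⟨j, c⟩ ⟨hj, y, hy, -⟩
    simp only at hj hy
    subst hy
    simp only [Finset.coe_product, Set.mem_prod, Finset.mem_coe, Finset.mem_range,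
      Fintype.mem_piFinset, Finset.mem_Icc]
    exact ⟨by omega, fun l => ⟨dyadicIndex_pos j y l, (dyadicIndex_le j y l).trans
      (pow_le_pow_right₀ (by norm_num) hj)⟩⟩
  have hdiff : ∀ {q q' x}, q ∈ Z → q' ∈ Z → x ∈ dyadicCell q.1 q.2 → x ∈ dyadicCell q'.1 q'.2 →
      ¬ q.1 < q'.1 := by
    rintro ⟨j, c⟩ ⟨j', c'⟩ x ⟨-, y, hy, hg⟩ ⟨-, y', hy', hg'⟩ hx hx' hlt
    simp only [mem_dyadicCell] at *
    have h1 := hgood (hy.trans hx.symm) hg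
    have h2 := hgood (hy'.trans hx'.symm) hg'
    exact absurd h1.1 (not_lt.2 (h2.2 j hlt))
  refine ⟨hZ.toFinset, ?_, ?_, ?_⟩
  · rintro ⟨j, c⟩ hq
    obtain ⟨-, y, hy, hg⟩ := hZ.mem_toFinset.1 hq
    simp only at hy hg
    subst hy
    refine ⟨⟨y, rfl⟩, hg.1, ?_⟩
    rcases j with _ | j
    · have : I 0 y ≤ L := (setIntegral_le_integral hfi.norm
        (.of_forall fun _ => norm_nonneg _)).trans hfL
      have h := hg.1
      simp only [v, pow_zero, inv_one, one_pow, mul_one] at h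
      exact absurd h (not_lt.2 this)
    · refine (setIntegral_norm_dyadicCell_mono hfi (Nat.le_succ j) y).trans
        ((hg.2 j (Nat.lt_succ_self j)).trans_eq ?_)
      simp only [v]
      rw [pow_succ, mul_inv, mul_pow, inv_pow 2]
      field_simp
  · intro q hq q' hq' hne
    rw [Function.onFun, Set.disjoint_left]
    intro x hx hx'
    have hqZ := hZ.mem_toFinset.1 hq
    have hqZ' := hZ.mem_toFinset.1 hq'
    have e : q.1 = q'.1 := le_antisymm (not_lt.1 (hdiff hqZ' hqZ hx' hx))
      (not_lt.1 (hdiff hqZ hqZ' hx hx'))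
    refine hne (Prod.ext e ?_)
    rw [mem_dyadicCell] at hx hx'
    rw [← hx, ← hx', e]
  · intro x hx
    have hno : ∀ j, j ≤ J → ¬ good j x := fun j hj hg =>
      hx (j, dyadicIndex j x) (hZ.mem_toFinset.2 ⟨hj, x, rfl, hg⟩) rfl
    have hall : ∀ j, j ≤ J → I j x ≤ L * v j := by
      intro j
      induction j using Nat.strong_induction_on with
      | _ j ih =>
        intro hj
        by_contra hlt
        exact hno j hj ⟨not_le.1 hlt, fun i hi => ih i hi (hi.le.trans hj)⟩
    have h1 := hall J le_rfl
    have hm := measurableSet_dyadicCell J (dyadicIndex J x)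
    have h2 : ∫ _t in dyadicCell J (dyadicIndex J x), (‖f x‖ - L) ∂haarTorus n ≤ I J x := by
      refine setIntegral_mono_on (integrable_const _).integrableOn hfi.norm.integrableOn hm ?_
      intro t ht
      have hd : dist x t < δ := by
        rw [dist_eq_norm]
        exact (norm_sub_le_of_dyadicIndex_eq (mem_dyadicCell.1 ht).symm).trans_lt hJ
      have h3 := hδf hd
      rw [dist_eq_norm] at h3
      have := norm_sub_norm_le (f x) (f t)
      linarith
    rw [setIntegral_const, haarTorus_real_dyadicCell, smul_eq_mul] at h2
    have h4 : v J * (‖f x‖ - L) ≤ v J * L := by linarith [mul_comm L (v J)]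
    have := le_of_mul_le_mul_left h4 (hv J)
    linarith

end Cells

section WeakType

variable {n : ℕ}

/-- The integral Hörmander condition with constant `H` for the kernel `K`, at dyadic radii. -/
def HormanderCond (H : ℝ) (K : UnitAddTorus (Fin n) → ℂ) : Prop :=
  ∀ (i : ℕ) (y : UnitAddTorus (Fin n)), ‖y‖ ≤ ((2 : ℝ) ^ i)⁻¹ →
    ∫ x in {x | 2 * ((2 : ℝ) ^ i)⁻¹ < ‖x‖}, ‖K (x - y) - K x‖ ∂haarTorus n ≤ H

lemma setIntegral_norm_sub_le {H : ℝ} {K : UnitAddTorus (Fin n) → ℂ} (hH : HormanderCond H K)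
    {i : ℕ} {y t : UnitAddTorus (Fin n)} (ht : ‖t - y‖ ≤ ((2 : ℝ) ^ i)⁻¹) :
    ∫ x in {x | 2 * ((2 : ℝ) ^ i)⁻¹ < ‖x - y‖}, ‖K (x - t) - K (x - y)‖ ∂haarTorus n ≤ H := by
  refine le_trans (le_of_eq ?_) (hH i (t - y) ht)
  have hm : MeasurableSet {x : UnitAddTorus (Fin n) | 2 * ((2 : ℝ) ^ i)⁻¹ < ‖x‖} :=
    (isOpen_lt continuous_const continuous_norm).measurableSet
  have hm' : MeasurableSet {x : UnitAddTorus (Fin n) | 2 * ((2 : ℝ) ^ i)⁻¹ < ‖x - y‖} :=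
    (isOpen_lt continuous_const (by fun_prop)).measurableSet
  rw [← integral_indicator hm, ← integral_indicator hm']
  refine Eq.trans ?_ (integral_sub_right_eq_self (μ := haarTorus n)
    (Set.indicator {x | 2 * ((2 : ℝ) ^ i)⁻¹ < ‖x‖} fun x => ‖K (x - (t - y)) - K x‖) y)
  congr 1
  funext x
  simp only [Set.indicator_apply, Set.mem_ofPred_eq]
  rw [show x - y - (t - y) = x - t by abel]

lemma setIntegral_norm_torusMul_le {m : (Fin n → ℤ) → ℂ} (hm : m.support.Finite) {H : ℝ}
    (hH : HormanderCond H (trigSeries m)) {b : UnitAddTorus (Fin n) → ℂ}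
    (hb : Integrable b (haarTorus n)) (hb0 : ∫ x, b x ∂haarTorus n = 0) {i : ℕ}
    {y : UnitAddTorus (Fin n)} (hby : ∀ t, b t ≠ 0 → ‖t - y‖ ≤ ((2 : ℝ) ^ i)⁻¹) :
    ∫ x in {x | 2 * ((2 : ℝ) ^ i)⁻¹ < ‖x - y‖}, ‖torusMul m b x‖ ∂haarTorus n
      ≤ H * ∫ x, ‖b x‖ ∂haarTorus n := by
  set K := trigSeries m with hK
  have hKc : Continuous K := continuous_trigSeries hm
  set E := {x : UnitAddTorus (Fin n) | 2 * ((2 : ℝ) ^ i)⁻¹ < ‖x - y‖}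
  obtain ⟨M, hM⟩ := isCompact_univ.exists_bound_of_continuousOn hKc.continuousOn
  have hM' : ∀ x t, ‖‖K (x - t) - K (x - y)‖‖ ≤ 2 * M := fun x t => by
    rw [norm_norm]
    refine (norm_sub_le _ _).trans ?_
    linarith [hM (x - t) trivial, hM (x - y) trivial]
  have hprod : Integrable (Function.uncurry fun x t => ‖K (x - t) - K (x - y)‖ * ‖b t‖)
      (((haarTorus n).restrict E).prod (haarTorus n)) := by
    have h1 : Integrable (fun z : UnitAddTorus (Fin n) × UnitAddTorus (Fin n) => ‖b z.2‖)
        (((haarTorus n).restrict E).prod (haarTorus n)) := hb.norm.comp_snd _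
    refine h1.bdd_mul (c := 2 * M) ?_ (.of_forall fun z => hM' z.1 z.2)
    exact Continuous.aestronglyMeasurable (by fun_prop)
  have hpt : ∀ x, ‖torusMul m b x‖ ≤ ∫ t, ‖K (x - t) - K (x - y)‖ * ‖b t‖ ∂haarTorus n := by
    intro x
    have hi : ∀ z : UnitAddTorus (Fin n), Integrable (fun t => K (x - z) * b t) (haarTorus n) :=
      fun z => hb.const_mul _
    have hi2 : Integrable (fun t => K (x - t) * b t) (haarTorus n) :=
      hb.bdd_mul (c := M) (Continuous.aestronglyMeasurable (by fun_prop))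
        (.of_forall fun t => hM _ trivial)
    have e : torusMul m b x = ∫ t, (K (x - t) - K (x - y)) * b t ∂haarTorus n := by
      rw [torusMul_eq_integral hm hb x]
      simp_rw [sub_mul]
      rw [integral_sub hi2 (hi y), integral_const_mul, hb0, mul_zero, sub_zero]
    rw [e]
    refine (norm_integral_le_integral_norm _).trans_eq ?_
    simp_rw [norm_mul]
  calc ∫ x in E, ‖torusMul m b x‖ ∂haarTorus n
      ≤ ∫ x in E, (∫ t, ‖K (x - t) - K (x - y)‖ * ‖b t‖ ∂haarTorus n) ∂haarTorus n := by
        refine integral_mono ?_ hprod.integral_prod_left fun x => hpt x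
        exact (integrable_of_continuous (continuous_torusMul hm b)).norm.integrableOn
    _ = ∫ t, (∫ x in E, ‖K (x - t) - K (x - y)‖ * ‖b t‖ ∂haarTorus n) ∂haarTorus n :=
        integral_integral_swap hprod
    _ ≤ ∫ t, H * ‖b t‖ ∂haarTorus n := by
        refine integral_mono hprod.integral_prod_right (hb.norm.const_mul H) fun t => ?_
        simp only
        rw [integral_mul_const]
        by_cases ht : b t = 0
        · simp [ht]
        · exact mul_le_mul_of_nonneg_right (setIntegral_norm_sub_le hH (hby t ht)) (norm_nonneg _)
    _ = H * ∫ x, ‖b x‖ ∂haarTorus n := integral_const_mul _ _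

lemma torusMul_finset_sum {ι : Type*} {m : (Fin n → ℤ) → ℂ} (hm : m.support.Finite)
    (S : Finset ι) {b : ι → UnitAddTorus (Fin n) → ℂ}
    (hb : ∀ q ∈ S, Integrable (b q) (haarTorus n)) (x : UnitAddTorus (Fin n)) :
    torusMul m (fun t => ∑ q ∈ S, b q t) x = ∑ q ∈ S, torusMul m (b q) x := by
  classical
  induction S using Finset.induction_on with
  | empty => simp [torusMul, torusCoeff, trigSeries]
  | insert a S ha ih =>
    simp_rw [Finset.sum_insert ha]
    rw [← ih fun q hq => hb q (Finset.mem_insert_of_mem hq)]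
    exact torusMul_add hm (hb a (Finset.mem_insert_self a S))
      (integrable_finsetSum _ fun q hq => hb q (Finset.mem_insert_of_mem hq)) x

lemma haarTorus_norm_sub_le_le (y : UnitAddTorus (Fin n)) {r : ℝ} (hr : 0 ≤ r) :
    haarTorus n {x | ‖x - y‖ ≤ r} ≤ ENNReal.ofReal ((2 * r) ^ n) := by
  have e : {x : UnitAddTorus (Fin n) | ‖x - y‖ ≤ r} = Metric.closedBall y r := by
    ext x
    simp [dist_eq_norm]
  rw [e, closedBall_pi _ hr, haarTorus, Measure.pi_pi, haarAddCircle_eq_volume]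
  simp_rw [AddCircle.volume_closedBall]
  rw [Finset.prod_const, Finset.card_univ, Fintype.card_fin, ENNReal.ofReal_pow (by positivity)]
  gcongr
  exact min_le_right _ _

lemma measure_lt_norm_le {α : Type*} {E : Type*} [NormedAddCommGroup E] {mα : MeasurableSpace α}
    {μ : Measure α} [IsFiniteMeasure μ]
    {F : α → E} (hF : Integrable F μ) {L : ℝ} (hL : 0 < L) :
    μ {x | L < ‖F x‖} ≤ ENNReal.ofReal ((∫ x, ‖F x‖ ∂μ) / L) := by
  have h := mul_meas_ge_le_integral_of_nonneg (.of_forall fun x => norm_nonneg (F x)) hF.norm L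
  have h1 : μ.real {x | L < ‖F x‖} ≤ (∫ x, ‖F x‖ ∂μ) / L := by
    rw [le_div_iff₀ hL, mul_comm]
    refine le_trans (mul_le_mul_of_nonneg_left (measureReal_mono ?_) hL.le) h
    exact fun x (hx : L < ‖F x‖) => show L ≤ ‖F x‖ from hx.le
  rw [← ENNReal.ofReal_toReal (measure_ne_top μ {x | L < ‖F x‖})]
  exact ENNReal.ofReal_le_ofReal h1

end WeakType

section CalderonZygmund

variable {n : ℕ}

lemma exists_calderonZygmund_decomposition {f : UnitAddTorus (Fin n) → ℂ} (hf : Continuous f)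
    {L : ℝ} (hL : 0 < L) (hfL : ∫ x, ‖f x‖ ∂haarTorus n ≤ L) :
    ∃ (S : Finset (ℕ × (Fin n → ℤ))) (Y : ℕ × (Fin n → ℤ) → UnitAddTorus (Fin n))
      (g : UnitAddTorus (Fin n) → ℂ) (b : ℕ × (Fin n → ℤ) → UnitAddTorus (Fin n) → ℂ),
      (∀ x, f x = g x + ∑ q ∈ S, b q x) ∧ (∀ x, ‖g x‖ ≤ (2 ^ n + 2) * L) ∧
      Integrable g (haarTorus n) ∧ ∫ x, ‖g x‖ ∂haarTorus n ≤ 3 * ∫ x, ‖f x‖ ∂haarTorus n ∧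
      (∀ q ∈ S, Integrable (b q) (haarTorus n) ∧ ∫ x, b q x ∂haarTorus n = 0 ∧
        ∀ t, b q t ≠ 0 → ‖t - Y q‖ ≤ ((2 : ℝ) ^ q.1)⁻¹) ∧
      ∑ q ∈ S, ∫ x, ‖b q x‖ ∂haarTorus n ≤ 2 * ∫ x, ‖f x‖ ∂haarTorus n ∧
      ∑ q ∈ S, ((2 : ℝ) ^ q.1)⁻¹ ^ n ≤ (∫ x, ‖f x‖ ∂haarTorus n) / L := by
  classical
  have hfi : Integrable f (haarTorus n) := integrable_of_continuous hf
  obtain ⟨S, hS, hdisj, hoff⟩ := exists_stopping_cells hf hL hfL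
  let Q : ℕ × (Fin n → ℤ) → Set (UnitAddTorus (Fin n)) := fun q => dyadicCell q.1 q.2
  have hQm : ∀ q, MeasurableSet (Q q) := fun q => measurableSet_dyadicCell q.1 q.2
  let v : ℕ × (Fin n → ℤ) → ℝ := fun q => ((2 : ℝ) ^ q.1)⁻¹ ^ n
  have hv : ∀ q, 0 < v q := fun q => by positivity
  have hvol : ∀ q ∈ S, (haarTorus n).real (Q q) = v q := fun q hq => by
    obtain ⟨y, hy⟩ := (hS q hq).1
    have h := haarTorus_real_dyadicCell q.1 y
    rwa [hy] at h
  let a : ℕ × (Fin n → ℤ) → ℂ := fun q => ((v q)⁻¹ : ℝ) • ∫ x in Q q, f x ∂haarTorus n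
  have hva : ∀ q, v q • a q = ∫ x in Q q, f x ∂haarTorus n := fun q => by
    simp only [a]
    rw [smul_smul, mul_inv_cancel₀ (hv q).ne', one_smul]
  have hva_le : ∀ q, v q * ‖a q‖ ≤ ∫ x in Q q, ‖f x‖ ∂haarTorus n := fun q => by
    have h := congrArg norm (hva q)
    rw [norm_smul, Real.norm_of_nonneg (hv q).le] at h
    rw [h]
    exact norm_integral_le_integral_norm _
  let b : ℕ × (Fin n → ℤ) → UnitAddTorus (Fin n) → ℂ := fun q => (Q q).indicator fun x => f x - a q
  have hbi : ∀ q, Integrable (b q) (haarTorus n) := fun q =>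
    (hfi.sub (integrable_const _)).indicator (hQm q)
  have hsum : ∑ q ∈ S, ∫ x in Q q, ‖f x‖ ∂haarTorus n ≤ ∫ x, ‖f x‖ ∂haarTorus n := by
    rw [← integral_biUnion_finset S (fun q _ => hQm q) hdisj fun q _ => hfi.norm.integrableOn]
    exact setIntegral_le_integral hfi.norm (.of_forall fun _ => norm_nonneg _)
  have hbn : ∀ q ∈ S, ∫ x, ‖b q x‖ ∂haarTorus n ≤ 2 * ∫ x in Q q, ‖f x‖ ∂haarTorus n := by
    intro q hq
    have e : ∀ x, ‖b q x‖ = (Q q).indicator (fun x => ‖f x - a q‖) x := fun x =>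
      norm_indicator_eq_indicator_norm _ _
    simp_rw [e]
    rw [integral_indicator (hQm q)]
    calc ∫ x in Q q, ‖f x - a q‖ ∂haarTorus n
        ≤ ∫ x in Q q, (‖f x‖ + ‖a q‖) ∂haarTorus n :=
          integral_mono (hfi.sub (integrable_const _)).norm.integrableOn
            (hfi.norm.add (integrable_const _)).integrableOn fun x => norm_sub_le _ _
      _ = ∫ x in Q q, ‖f x‖ ∂haarTorus n + v q * ‖a q‖ := by
          rw [integral_add hfi.norm.integrableOn (integrable_const _).integrableOn,
            setIntegral_const, hvol q hq, smul_eq_mul]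
      _ ≤ _ := by linarith [hva_le q]
  have hbS : ∑ q ∈ S, ∫ x, ‖b q x‖ ∂haarTorus n ≤ 2 * ∫ x, ‖f x‖ ∂haarTorus n := by
    refine (Finset.sum_le_sum hbn).trans ?_
    rw [← Finset.mul_sum]
    linarith
  have hBi : Integrable (fun x => ∑ q ∈ S, b q x) (haarTorus n) :=
    integrable_finsetSum _ fun q _ => hbi q
  refine ⟨S, fun q => if h : ∃ y, dyadicIndex q.1 y = q.2 then h.choose else 0,
    fun x => f x - ∑ q ∈ S, b q x, b, fun x => by ring, ?_, hfi.sub hBi, ?_, ?_, hbS, ?_⟩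
  · intro x
    change ‖f x - ∑ q ∈ S, b q x‖ ≤ _
    by_cases hx : ∃ q ∈ S, x ∈ Q q
    · obtain ⟨q, hq, hxq⟩ := hx
      have e : ∑ q' ∈ S, b q' x = f x - a q := by
        rw [Finset.sum_eq_single q]
        · exact Set.indicator_of_mem hxq _
        · intro q' hq' hne
          refine Set.indicator_of_notMem (fun hxq' => ?_) _
          exact Set.disjoint_left.1 (hdisj hq' hq hne) hxq' hxq
        · exact fun h => absurd hq h
      rw [e, _root_.sub_sub_cancel]
      have h1 : v q * ‖a q‖ ≤ v q * (2 ^ n * L) := by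
        refine (hva_le q).trans ((hS q hq).2.2.trans_eq ?_)
        simp only [v]
        ring
      have h2 := le_of_mul_le_mul_left h1 (hv q)
      linarith
    · push Not at hx
      have e : ∑ q' ∈ S, b q' x = 0 :=
        Finset.sum_eq_zero fun q hq => Set.indicator_of_notMem (hx q hq) _
      rw [e, sub_zero]
      refine (hoff x hx).trans ?_
      have : (0 : ℝ) ≤ 2 ^ n * L := by positivity
      linarith
  · calc ∫ x, ‖f x - ∑ q ∈ S, b q x‖ ∂haarTorus n
        ≤ ∫ x, (‖f x‖ + ∑ q ∈ S, ‖b q x‖) ∂haarTorus n := by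
          refine integral_mono (hfi.sub hBi).norm
            (hfi.norm.add (integrable_finsetSum _ fun q _ => (hbi q).norm)) fun x => ?_
          exact (norm_sub_le _ _).trans (add_le_add le_rfl (norm_sum_le _ _))
      _ = ∫ x, ‖f x‖ ∂haarTorus n + ∑ q ∈ S, ∫ x, ‖b q x‖ ∂haarTorus n := by
          rw [integral_add hfi.norm (integrable_finsetSum _ fun q _ => (hbi q).norm),
            integral_finsetSum _ fun q _ => (hbi q).norm]
      _ ≤ _ := by linarith
  · intro q hq
    refine ⟨hbi q, ?_, fun t ht => ?_⟩
    · simp only [b]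
      rw [integral_indicator (hQm q), integral_sub hfi.integrableOn
        (integrable_const _).integrableOn, setIntegral_const, hvol q hq, hva q, sub_self]
    · have htQ : t ∈ Q q := by
        by_contra h
        exact ht (Set.indicator_of_notMem h _)
      simp only [dif_pos (hS q hq).1]
      exact norm_sub_le_of_dyadicIndex_eq
        ((mem_dyadicCell.1 htQ).trans (hS q hq).1.choose_spec.symm)
  · rw [le_div_iff₀ hL, Finset.sum_mul]
    refine le_trans (Finset.sum_le_sum fun q hq => ?_) hsum
    rw [mul_comm]
    exact (hS q hq).2.1.le

lemma weak_type_torusMul {m : (Fin n → ℤ) → ℂ} (hm : m.support.Finite) {A H : ℝ}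
    (hA : ∀ ξ, ‖m ξ‖ ≤ A) (hH0 : 0 ≤ H) (hH : HormanderCond H (trigSeries m))
    {f : UnitAddTorus (Fin n) → ℂ} (hf : Continuous f) {L : ℝ} (hL : 0 < L) :
    haarTorus n {x | L < ‖torusMul m f x‖} ≤
      ENNReal.ofReal ((12 * A ^ 2 * (2 ^ n + 2) + 4 ^ n + 4 * H + 1)
        * ((∫ x, ‖f x‖ ∂haarTorus n) / L)) := by
  have hN0 : 0 ≤ ∫ x, ‖f x‖ ∂haarTorus n := integral_nonneg fun _ => norm_nonneg _
  rcases lt_or_ge L (∫ x, ‖f x‖ ∂haarTorus n) with hbig | hfL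
  · refine prob_le_one.trans ?_
    rw [ENNReal.one_le_ofReal]
    have h1 : 1 ≤ (∫ x, ‖f x‖ ∂haarTorus n) / L := (one_le_div hL).2 hbig.le
    have h2 : (1 : ℝ) ≤ 12 * A ^ 2 * (2 ^ n + 2) + 4 ^ n + 4 * H + 1 := by
      have : (0 : ℝ) ≤ 12 * A ^ 2 * (2 ^ n + 2) + 4 ^ n + 4 * H := by positivity
      linarith
    exact one_le_mul_of_one_le_of_one_le h2 h1
  obtain ⟨S, Y, g, b, hfgb, hgb, hgi, hg1, hb, hb1, hS1⟩ :=
    exists_calderonZygmund_decomposition hf hL hfL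
  set N := ∫ x, ‖f x‖ ∂haarTorus n with hN
  have hbi : ∀ q ∈ S, Integrable (b q) (haarTorus n) := fun q hq => (hb q hq).1
  have hT : ∀ x, torusMul m f x = torusMul m g x + ∑ q ∈ S, torusMul m (b q) x := fun x => by
    rw [← torusMul_finset_sum hm S hbi, ← torusMul_add hm hgi (integrable_finsetSum _ hbi)]
    congr 1
    exact funext hfgb
  let E : ℕ × (Fin n → ℤ) → Set (UnitAddTorus (Fin n)) := fun q =>
    {x | 2 * ((2 : ℝ) ^ q.1)⁻¹ < ‖x - Y q‖}
  have hEm : ∀ q, MeasurableSet (E q) := fun q =>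
    (isOpen_lt continuous_const (by fun_prop)).measurableSet
  let W : UnitAddTorus (Fin n) → ℝ := fun x => ∑ q ∈ S, (E q).indicator (fun x => ‖torusMul m (b q) x‖) x
  have hbT : ∀ q, Integrable (fun x => ‖torusMul m (b q) x‖) (haarTorus n) := fun q =>
    (integrable_of_continuous (continuous_torusMul hm (b q))).norm
  have hWi : Integrable W (haarTorus n) :=
    integrable_finsetSum _ fun q _ => (hbT q).indicator (hEm q)
  have hW0 : ∀ x, 0 ≤ W x := fun x =>
    Finset.sum_nonneg fun q _ => Set.indicator_nonneg (fun _ _ => norm_nonneg _) _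
  have hsub : {x | L < ‖torusMul m f x‖} ⊆
      ({x | L / 2 < ‖torusMul m g x‖} ∪ ⋃ q ∈ S, {x | ‖x - Y q‖ ≤ 2 * ((2 : ℝ) ^ q.1)⁻¹}) ∪
        {x | L / 2 < ‖W x‖} := by
    intro x (hx : L < ‖torusMul m f x‖)
    by_contra hcon
    simp only [Set.mem_union, Set.mem_ofPred_eq, Set.mem_iUnion, not_or, not_exists, not_lt,
      not_le, exists_prop, not_and] at hcon
    obtain ⟨⟨h1, h2⟩, h3⟩ := hcon
    have h4 : ‖∑ q ∈ S, torusMul m (b q) x‖ ≤ W x := by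
      refine (norm_sum_le _ _).trans (Finset.sum_le_sum fun q hq => ?_)
      rw [Set.indicator_of_mem (show x ∈ E q from h2 q hq)]
    rw [Real.norm_of_nonneg (hW0 x)] at h3
    rw [hT x] at hx
    linarith [norm_add_le (torusMul m g x) (∑ q ∈ S, torusMul m (b q) x)]
  have hm1 : haarTorus n {x | L / 2 < ‖torusMul m g x‖} ≤
      ENNReal.ofReal (12 * A ^ 2 * (2 ^ n + 2) * (N / L)) := by
    have hgL2 : MemLp g 2 (haarTorus n) :=
      MemLp.of_bound hgi.aestronglyMeasurable _ (.of_forall hgb)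
    have hTg : Integrable (fun x => ‖torusMul m g x‖ ^ 2) (haarTorus n) := by
      refine Continuous.integrable_of_hasCompactSupport ?_ (HasCompactSupport.of_compactSpace _)
      exact (continuous_torusMul hm g).norm.pow 2
    have h1 := measure_lt_norm_le hTg (L := (L / 2) ^ 2) (by positivity)
    have h2 : ∫ x, ‖g x‖ ^ 2 ∂haarTorus n ≤ (2 ^ n + 2) * L * (3 * N) := by
      calc ∫ x, ‖g x‖ ^ 2 ∂haarTorus n ≤ ∫ x, (2 ^ n + 2) * L * ‖g x‖ ∂haarTorus n := by
            refine integral_mono (hgL2.integrable_norm_pow (by norm_num))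
              (hgi.norm.const_mul _) fun x => ?_
            simp only
            rw [sq]
            exact mul_le_mul_of_nonneg_right (hgb x) (norm_nonneg _)
        _ = (2 ^ n + 2) * L * ∫ x, ‖g x‖ ∂haarTorus n := integral_const_mul _ _
        _ ≤ _ := mul_le_mul_of_nonneg_left hg1 (by positivity)
    refine le_trans (measure_mono ?_) (h1.trans (ENNReal.ofReal_le_ofReal ?_))
    · intro x (hx : L / 2 < ‖torusMul m g x‖)
      show (L / 2) ^ 2 < ‖‖torusMul m g x‖ ^ 2‖
      rw [norm_pow, norm_norm]
      exact pow_lt_pow_left₀ hx (by positivity) (by norm_num)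
    · simp_rw [norm_pow, norm_norm]
      rw [div_le_iff₀ (by positivity)]
      refine (integral_sq_torusMul_le hm hA hgL2).trans
        ((mul_le_mul_of_nonneg_left h2 (sq_nonneg A)).trans_eq ?_)
      field_simp
      ring
  have hm2 : haarTorus n (⋃ q ∈ S, {x | ‖x - Y q‖ ≤ 2 * ((2 : ℝ) ^ q.1)⁻¹}) ≤
      ENNReal.ofReal (4 ^ n * (N / L)) := by
    refine (measure_biUnion_finset_le S _).trans ?_
    refine (Finset.sum_le_sum fun q _ => haarTorus_norm_sub_le_le (Y q) (by positivity)).trans ?_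
    rw [← ENNReal.ofReal_sum_of_nonneg fun q _ => by positivity]
    refine ENNReal.ofReal_le_ofReal ?_
    calc ∑ q ∈ S, (2 * (2 * ((2 : ℝ) ^ q.1)⁻¹)) ^ n
        = 4 ^ n * ∑ q ∈ S, ((2 : ℝ) ^ q.1)⁻¹ ^ n := by
          rw [Finset.mul_sum]
          refine Finset.sum_congr rfl fun q _ => ?_
          rw [← mul_pow]
          ring
      _ ≤ _ := mul_le_mul_of_nonneg_left hS1 (by positivity)
  have hm3 : haarTorus n {x | L / 2 < ‖W x‖} ≤ ENNReal.ofReal (4 * H * (N / L)) := by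
    refine (measure_lt_norm_le hWi (by positivity)).trans (ENNReal.ofReal_le_ofReal ?_)
    have h1 : ∫ x, ‖W x‖ ∂haarTorus n ≤ H * (2 * N) := by
      simp_rw [fun x => Real.norm_of_nonneg (hW0 x)]
      rw [integral_finsetSum _ fun q _ => (hbT q).indicator (hEm q)]
      refine le_trans (Finset.sum_le_sum fun q hq => ?_)
        ((Finset.mul_sum S _ H).symm.trans_le (mul_le_mul_of_nonneg_left hb1 hH0))
      rw [integral_indicator (hEm q)]
      exact setIntegral_norm_torusMul_le hm hH (hb q hq).1 (hb q hq).2.1 (hb q hq).2.2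
    rw [div_le_iff₀ (by positivity)]
    refine h1.trans_eq ?_
    field_simp
    ring
  have hNL : 0 ≤ N / L := by positivity
  calc haarTorus n {x | L < ‖torusMul m f x‖}
      ≤ ENNReal.ofReal (12 * A ^ 2 * (2 ^ n + 2) * (N / L)) + ENNReal.ofReal (4 ^ n * (N / L))
        + ENNReal.ofReal (4 * H * (N / L)) := by
        refine (measure_mono hsub).trans ((measure_union_le _ _).trans (add_le_add ?_ hm3))
        exact (measure_union_le _ _).trans (add_le_add hm1 hm2)
    _ = ENNReal.ofReal ((12 * A ^ 2 * (2 ^ n + 2) + 4 ^ n + 4 * H) * (N / L)) := by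
        rw [← ENNReal.ofReal_add (by positivity) (by positivity),
          ← ENNReal.ofReal_add (by positivity) (by positivity)]
        congr 1
        ring
    _ ≤ _ := ENNReal.ofReal_le_ofReal (mul_le_mul_of_nonneg_right (by linarith) hNL)

end CalderonZygmund

section Interpolation

variable {n : ℕ}

lemma lintegral_Ioc_rpow {r a : ℝ} (hr : -1 < r) (ha : 0 ≤ a) {c : ℝ} (hc : 0 ≤ c) :
    ∫⁻ s in Set.Ioc 0 a, ENNReal.ofReal (c * s ^ r) = ENNReal.ofReal (c * (a ^ (r + 1) / (r + 1))) := by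
  have hi : IntegrableOn (fun s : ℝ => c * s ^ r) (Set.Ioc 0 a) :=
    ((intervalIntegrable_iff_integrableOn_Ioc_of_le ha).1
      (intervalIntegral.intervalIntegrable_rpow' hr)).const_mul c
  rw [← ofReal_integral_eq_lintegral_ofReal hi]
  · rw [integral_const_mul, ← intervalIntegral.integral_of_le ha, integral_rpow (.inl hr),
      Real.zero_rpow (by linarith), sub_zero]
  · refine (ae_restrict_iff' measurableSet_Ioc).2 (.of_forall fun s hs => ?_)
    exact mul_nonneg hc (Real.rpow_nonneg hs.1.le _)

lemma lintegral_Ioi_rpow {r a : ℝ} (hr : r < -1) (ha : 0 < a) {c : ℝ} (hc : 0 ≤ c) :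
    ∫⁻ s in Set.Ioi a, ENNReal.ofReal (c * s ^ r)
      = ENNReal.ofReal (c * (-a ^ (r + 1) / (r + 1))) := by
  have hi : IntegrableOn (fun s : ℝ => c * s ^ r) (Set.Ioi a) :=
    (integrableOn_Ioi_rpow_of_lt hr ha).const_mul c
  rw [← ofReal_integral_eq_lintegral_ofReal hi]
  · rw [integral_const_mul, integral_Ioi_rpow_of_lt hr ha]
  · refine (ae_restrict_iff' measurableSet_Ioi).2 (.of_forall fun s hs => ?_)
    exact mul_nonneg hc (Real.rpow_nonneg (ha.le.trans (le_of_lt hs)) _)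

lemma lintegral_truncation_le {p a α β : ℝ} (h1 : 1 < p) (h2 : p < 2) (ha : 0 ≤ a) (hα : 0 ≤ α)
    (hβ : 0 ≤ β) :
    ∫⁻ s in Set.Ioi (0 : ℝ), ENNReal.ofReal
        ((α * (min a s) ^ 2 / s ^ 2 + β * max (a - s) 0 / s) * s ^ (p - 1))
      ≤ ENNReal.ofReal ((α * (1 / p + 1 / (2 - p)) + β / (p - 1)) * a ^ p) := by
  rcases ha.eq_or_lt with rfl | ha
  · refine le_of_eq_of_le ?_ zero_le
    refine (setLIntegral_congr_fun measurableSet_Ioi fun s hs => ?_).trans lintegral_zero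
    have hs : 0 < s := hs
    simp [hs.le]
  have hp1 : 0 < p - 1 := by linarith
  have hp2 : 0 < 2 - p := by linarith
  rw [← Set.Ioc_union_Ioi_eq_Ioi ha.le]
  refine (lintegral_union_le _ _ _).trans ?_
  have e1 : ∫⁻ s in Set.Ioc 0 a, ENNReal.ofReal
      ((α * (min a s) ^ 2 / s ^ 2 + β * max (a - s) 0 / s) * s ^ (p - 1))
      ≤ ENNReal.ofReal (α * (a ^ p / p) + β * a * (a ^ (p - 1) / (p - 1))) := by
    calc _ ≤ ∫⁻ s in Set.Ioc 0 a,
          (ENNReal.ofReal (α * s ^ (p - 1)) + ENNReal.ofReal (β * a * s ^ (p - 2))) := by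
          refine setLIntegral_mono' measurableSet_Ioc fun s hs => ?_
          obtain ⟨hs0, hsa⟩ := hs
          rw [← ENNReal.ofReal_add (by positivity) (by positivity)]
          refine ENNReal.ofReal_le_ofReal ?_
          rw [min_eq_right hsa, max_eq_left (by linarith), mul_div_assoc, div_self (by positivity),
            mul_one, add_mul]
          have e : s ^ (p - 2) = s ^ (p - 1) / s := by
            rw [← Real.rpow_sub_one hs0.ne']
            congr 1
            ring
          rw [e]
          refine add_le_add le_rfl ?_
          rw [div_mul_eq_mul_div, mul_div_assoc, mul_assoc β a, mul_assoc β (a - s)]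
          gcongr
          linarith
      _ = _ := by
          rw [lintegral_add_left (by fun_prop), lintegral_Ioc_rpow (by linarith) ha.le hα,
            lintegral_Ioc_rpow (by linarith) ha.le (by positivity),
            ← ENNReal.ofReal_add (by positivity)]
          · congr 3
            · ring_nf
            · ring_nf
          · have : 0 < p - 2 + 1 := by linarith
            positivity
  have e2 : ∫⁻ s in Set.Ioi a, ENNReal.ofReal
      ((α * (min a s) ^ 2 / s ^ 2 + β * max (a - s) 0 / s) * s ^ (p - 1))
      = ENNReal.ofReal (α * a ^ 2 * (a ^ (p - 2) / (2 - p))) := by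
    calc _ = ∫⁻ s in Set.Ioi a, ENNReal.ofReal (α * a ^ 2 * s ^ (p - 3)) := by
          refine setLIntegral_congr_fun measurableSet_Ioi fun s hs => ?_
          have hs : a < s := hs
          have hs0 : 0 < s := ha.trans hs
          rw [min_eq_left hs.le, max_eq_right (by linarith)]
          congr 1
          have e : s ^ (p - 1) = s ^ (p - 3) * s ^ 2 := by
            rw [← Real.rpow_natCast, ← Real.rpow_add hs0]
            congr 1
            push_cast
            ring
          rw [e]
          field_simp
          ring
      _ = ENNReal.ofReal (α * a ^ 2 * (a ^ (p - 2) / (2 - p))) := by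
          rw [lintegral_Ioi_rpow (by linarith) ha (by positivity)]
          congr 2
          rw [show p - 3 + 1 = -(2 - p) by ring, neg_div_neg_eq, show p - 2 = -(2 - p) by ring]
  refine (add_le_add e1 e2.le).trans_eq ?_
  rw [← ENNReal.ofReal_add (by positivity) (by positivity)]
  congr 1
  have f1 : a ^ (p - 1) = a ^ p / a := by rw [Real.rpow_sub_one ha.ne']
  have f2 : a ^ (p - 2) = a ^ p / a ^ 2 := by
    rw [← Real.rpow_natCast, ← Real.rpow_sub ha]
    norm_num
  rw [f1, f2]
  field_simp
  ring

/-- The radial truncation of `f` at height `s`. -/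
def radialTrunc (s : ℝ) (f : UnitAddTorus (Fin n) → ℂ) (x : UnitAddTorus (Fin n)) : ℂ :=
  ((s / max s ‖f x‖ : ℝ) : ℂ) * f x

lemma continuous_radialTrunc {s : ℝ} (hs : 0 < s) {f : UnitAddTorus (Fin n) → ℂ}
    (hf : Continuous f) : Continuous (radialTrunc s f) := by
  unfold radialTrunc
  have h : ∀ x, max s ‖f x‖ ≠ 0 := fun x => (lt_max_of_lt_left hs).ne'
  exact (Complex.continuous_ofReal.comp
    (continuous_const.div (continuous_const.max hf.norm) h)).mul hf

lemma norm_radialTrunc {s : ℝ} (hs : 0 < s) (f : UnitAddTorus (Fin n) → ℂ)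
    (x : UnitAddTorus (Fin n)) : ‖radialTrunc s f x‖ = min ‖f x‖ s := by
  unfold radialTrunc
  rw [norm_mul, Complex.norm_real, Real.norm_of_nonneg (by positivity)]
  rcases le_total ‖f x‖ s with h | h
  · rw [max_eq_left h, min_eq_left h, div_self hs.ne', one_mul]
  · rw [max_eq_right h, min_eq_right h, div_mul_cancel₀]
    exact (hs.trans_le h).ne'

lemma norm_sub_radialTrunc {s : ℝ} (hs : 0 < s) (f : UnitAddTorus (Fin n) → ℂ)
    (x : UnitAddTorus (Fin n)) : ‖f x - radialTrunc s f x‖ = max (‖f x‖ - s) 0 := by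
  unfold radialTrunc
  rw [← one_sub_mul, norm_mul, ← Complex.ofReal_one, ← Complex.ofReal_sub, Complex.norm_real]
  rcases le_total ‖f x‖ s with h | h
  · rw [max_eq_left h, div_self hs.ne', max_eq_right (by linarith)]
    simp
  · have h0 : 0 < ‖f x‖ := hs.trans_le h
    rw [max_eq_right h, max_eq_left (by linarith), Real.norm_of_nonneg, sub_mul,
      div_mul_cancel₀ _ h0.ne', one_mul]
    rw [sub_nonneg]
    exact (div_le_one h0).2 h

lemma measure_lt_norm_torusMul_le {m : (Fin n → ℤ) → ℂ} (hm : m.support.Finite) {A W : ℝ}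
    (hA : ∀ ξ, ‖m ξ‖ ≤ A) (hW0 : 0 ≤ W)
    (hW : ∀ g : UnitAddTorus (Fin n) → ℂ, Continuous g → ∀ L : ℝ, 0 < L →
      haarTorus n {x | L < ‖torusMul m g x‖} ≤
        ENNReal.ofReal (W * ((∫ x, ‖g x‖ ∂haarTorus n) / L)))
    {f : UnitAddTorus (Fin n) → ℂ} (hf : Continuous f) {s : ℝ} (hs : 0 < s) :
    haarTorus n {x | s < ‖torusMul m f x‖} ≤ ∫⁻ x, ENNReal.ofReal
      (4 * A ^ 2 * (min ‖f x‖ s) ^ 2 / s ^ 2 + 2 * W * max (‖f x‖ - s) 0 / s) ∂haarTorus n := by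
  have hg := continuous_radialTrunc hs hf
  have hh : Continuous fun x => f x - radialTrunc s f x := hf.sub hg
  have hsub : {x | s < ‖torusMul m f x‖} ⊆ {x | s / 2 < ‖torusMul m (radialTrunc s f) x‖} ∪
      {x | s / 2 < ‖torusMul m (fun x => f x - radialTrunc s f x) x‖} := by
    intro x (hx : s < ‖torusMul m f x‖)
    by_contra hcon
    simp only [Set.mem_union, Set.mem_ofPred_eq, not_or, not_lt] at hcon
    have e : torusMul m f x = torusMul m (radialTrunc s f) x
        + torusMul m (fun x => f x - radialTrunc s f x) x := by
      rw [← torusMul_add hm (integrable_of_continuous hg) (integrable_of_continuous hh)]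
      congr 1
      funext t
      ring
    have := norm_add_le (torusMul m (radialTrunc s f) x)
      (torusMul m (fun x => f x - radialTrunc s f x) x)
    rw [← e] at this
    linarith [hcon.1, hcon.2]
  have hint : ∀ {F : UnitAddTorus (Fin n) → ℝ}, Continuous F → Integrable F (haarTorus n) :=
    fun hF => hF.integrable_of_hasCompactSupport (HasCompactSupport.of_compactSpace _)
  have h1 : haarTorus n {x | s / 2 < ‖torusMul m (radialTrunc s f) x‖} ≤
      ENNReal.ofReal (4 * A ^ 2 / s ^ 2 * ∫ x, (min ‖f x‖ s) ^ 2 ∂haarTorus n) := by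
    have hTg : Integrable (fun x => ‖torusMul m (radialTrunc s f) x‖ ^ 2) (haarTorus n) :=
      hint ((continuous_torusMul hm _).norm.pow 2)
    have h1 := measure_lt_norm_le hTg (L := (s / 2) ^ 2) (by positivity)
    refine le_trans (measure_mono ?_) (h1.trans (ENNReal.ofReal_le_ofReal ?_))
    · intro x (hx : s / 2 < ‖torusMul m (radialTrunc s f) x‖)
      show (s / 2) ^ 2 < ‖‖torusMul m (radialTrunc s f) x‖ ^ 2‖
      rw [norm_pow, norm_norm]
      exact pow_lt_pow_left₀ hx (by positivity) (by norm_num)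
    · simp_rw [norm_pow, norm_norm]
      rw [div_le_iff₀ (by positivity)]
      have hL2 : MemLp (radialTrunc s f) 2 (haarTorus n) :=
        MemLp.of_bound hg.aestronglyMeasurable s
          (.of_forall fun x => (norm_radialTrunc hs f x).trans_le (min_le_right _ _))
      refine (integral_sq_torusMul_le hm hA hL2).trans_eq ?_
      simp_rw [norm_radialTrunc hs f]
      field_simp
      ring
  have h2 : haarTorus n {x | s / 2 < ‖torusMul m (fun x => f x - radialTrunc s f x) x‖} ≤
      ENNReal.ofReal (2 * W / s * ∫ x, max (‖f x‖ - s) 0 ∂haarTorus n) := by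
    refine (hW _ hh (s / 2) (by positivity)).trans_eq ?_
    simp_rw [norm_sub_radialTrunc hs f]
    congr 1
    field_simp
  have hmin0 : ∀ x, 0 ≤ min ‖f x‖ s := fun x => le_min (norm_nonneg _) hs.le
  have hmax0 : ∀ x, 0 ≤ max (‖f x‖ - s) 0 := fun x => le_max_right _ _
  have hc1 : Continuous fun x => (min ‖f x‖ s) ^ 2 := (hf.norm.min continuous_const).pow 2
  have hc2 : Continuous fun x => max (‖f x‖ - s) 0 := (hf.norm.sub continuous_const).max continuous_const
  rw [← ofReal_integral_eq_lintegral_ofReal]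
  · refine (measure_mono hsub).trans ((measure_union_le _ _).trans ((add_le_add h1 h2).trans_eq ?_))
    rw [← ENNReal.ofReal_add
      (mul_nonneg (by positivity) (integral_nonneg fun x => by positivity))
      (mul_nonneg (by positivity) (integral_nonneg hmax0))]
    congr 1
    rw [← integral_const_mul, ← integral_const_mul, ← integral_add]
    · refine integral_congr_ae (.of_forall fun x => ?_)
      simp only
      ring
    · exact hint (continuous_const.mul hc1)
    · exact hint (continuous_const.mul hc2)
  · refine hint ?_
    exact ((continuous_const.mul hc1).div_const _).add ((continuous_const.mul hc2).div_const _)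
  · refine .of_forall fun x => ?_
    have := hmax0 x
    simp only [Pi.zero_apply]
    positivity

lemma integral_rpow_torusMul_le_of_lt_two {m : (Fin n → ℤ) → ℂ} (hm : m.support.Finite) {A W p : ℝ}
    (h1 : 1 < p) (h2 : p < 2)
    (hA : ∀ ξ, ‖m ξ‖ ≤ A) (hW0 : 0 ≤ W)
    (hW : ∀ g : UnitAddTorus (Fin n) → ℂ, Continuous g → ∀ L : ℝ, 0 < L →
      haarTorus n {x | L < ‖torusMul m g x‖} ≤
        ENNReal.ofReal (W * ((∫ x, ‖g x‖ ∂haarTorus n) / L)))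
    {f : UnitAddTorus (Fin n) → ℂ} (hf : Continuous f) :
    ∫ x, ‖torusMul m f x‖ ^ p ∂haarTorus n ≤
      p * (4 * A ^ 2 * (1 / p + 1 / (2 - p)) + 2 * W / (p - 1)) *
        ∫ x, ‖f x‖ ^ p ∂haarTorus n := by
  have hp0 : 0 < p := by linarith
  have hp1 : 0 < p - 1 := by linarith
  have hp2 : 0 < 2 - p := by linarith
  have hint : ∀ {F : UnitAddTorus (Fin n) → ℝ}, Continuous F → Integrable F (haarTorus n) :=
    fun hF => hF.integrable_of_hasCompactSupport (HasCompactSupport.of_compactSpace _)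
  have hTc := continuous_torusMul hm f
  have hTi : Integrable (fun x => ‖torusMul m f x‖ ^ p) (haarTorus n) :=
    hint (hTc.norm.rpow_const fun _ => .inr hp0.le)
  have hfi : Integrable (fun x => ‖f x‖ ^ p) (haarTorus n) :=
    hint (hf.norm.rpow_const fun _ => .inr hp0.le)
  set D := 4 * A ^ 2 * (1 / p + 1 / (2 - p)) + 2 * W / (p - 1) with hD
  have hD0 : 0 ≤ D := by positivity
  have hI0 : 0 ≤ ∫ x, ‖f x‖ ^ p ∂haarTorus n := integral_nonneg fun _ => by positivity
  rw [← ENNReal.ofReal_le_ofReal_iff (by positivity),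
    ofReal_integral_eq_lintegral_ofReal hTi (.of_forall fun _ => by positivity),
    lintegral_rpow_eq_lintegral_meas_lt_mul (haarTorus n) (.of_forall fun x => norm_nonneg _)
      hTc.norm.aemeasurable hp0, mul_assoc p, ENNReal.ofReal_mul hp0.le]
  gcongr
  calc ∫⁻ s in Set.Ioi (0 : ℝ), haarTorus n {x | s < ‖torusMul m f x‖} * ENNReal.ofReal (s ^ (p - 1))
      ≤ ∫⁻ s in Set.Ioi (0 : ℝ), ∫⁻ x, ENNReal.ofReal
        ((4 * A ^ 2 * (min ‖f x‖ s) ^ 2 / s ^ 2 + 2 * W * max (‖f x‖ - s) 0 / s) * s ^ (p - 1))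
          ∂haarTorus n := by
        refine setLIntegral_mono' measurableSet_Ioi fun s hs => ?_
        have hs : 0 < s := hs
        refine (mul_le_mul_left (measure_lt_norm_torusMul_le hm hA hW0 hW hf hs) _).trans_eq ?_
        rw [← lintegral_mul_const _ (by fun_prop)]
        refine lintegral_congr fun x => ?_
        rw [ENNReal.ofReal_mul]
        have : 0 ≤ max (‖f x‖ - s) 0 := le_max_right _ _
        positivity
    _ = ∫⁻ x, (∫⁻ s in Set.Ioi (0 : ℝ), ENNReal.ofReal
        ((4 * A ^ 2 * (min ‖f x‖ s) ^ 2 / s ^ 2 + 2 * W * max (‖f x‖ - s) 0 / s) * s ^ (p - 1)))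
          ∂haarTorus n := by
        refine lintegral_lintegral_swap (Measurable.aemeasurable ?_)
        have hfm : Measurable f := hf.measurable
        unfold Function.uncurry
        fun_prop
    _ ≤ ∫⁻ x, ENNReal.ofReal (D * ‖f x‖ ^ p) ∂haarTorus n :=
        lintegral_mono fun x => lintegral_truncation_le h1 h2 (norm_nonneg _) (by positivity)
          (by positivity)
    _ = ENNReal.ofReal (D * ∫ x, ‖f x‖ ^ p ∂haarTorus n) := by
        rw [← ofReal_integral_eq_lintegral_ofReal (hfi.const_mul D)
          (.of_forall fun _ => by positivity), integral_const_mul]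

end Interpolation

section LpBound

variable {n : ℕ}

lemma Continuous.integrable_haarTorus {E : Type*} [NormedAddCommGroup E]
    {F : UnitAddTorus (Fin n) → E} (hF : Continuous F) : Integrable F (haarTorus n) :=
  hF.integrable_of_hasCompactSupport (HasCompactSupport.of_compactSpace _)

lemma Continuous.memLp_haarTorus {E : Type*} [NormedAddCommGroup E]
    {F : UnitAddTorus (Fin n) → E} (hF : Continuous F) (p : ℝ≥0∞) : MemLp F p (haarTorus n) :=
  hF.memLp_of_hasCompactSupport (HasCompactSupport.of_compactSpace _)

lemma integral_rpow_torusMul_le_of_dual {m : (Fin n → ℤ) → ℂ} (hm : m.support.Finite) {p q D : ℝ}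
    (hp : 2 ≤ p) (hpq : p.HolderConjugate q) (hD : 0 ≤ D)
    (hdual : ∀ g : UnitAddTorus (Fin n) → ℂ, Continuous g →
      ∫ x, ‖torusMul (fun ξ => (starRingEnd ℂ) (m ξ)) g x‖ ^ q ∂haarTorus n
        ≤ D * ∫ x, ‖g x‖ ^ q ∂haarTorus n)
    {f : UnitAddTorus (Fin n) → ℂ} (hf : Continuous f) :
    (∫ x, ‖torusMul m f x‖ ^ p ∂haarTorus n) ^ (1 / p)
      ≤ D ^ (1 / q) * (∫ x, ‖f x‖ ^ p ∂haarTorus n) ^ (1 / p) := by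
  have hp0 : 0 < p := by linarith
  have hq0 : 0 < q := hpq.symm.pos
  set u := torusMul m f with hu
  have huc : Continuous u := continuous_torusMul hm f
  have hm' : (fun ξ => (starRingEnd ℂ) (m ξ)).support.Finite := by
    refine hm.subset fun ξ hξ => ?_
    simpa using hξ
  let g : UnitAddTorus (Fin n) → ℂ := fun x => ((‖u x‖ ^ (p - 2) : ℝ) : ℂ) * u x
  have hgc : Continuous g :=
    (Complex.continuous_ofReal.comp (huc.norm.rpow_const fun _ => .inr (by linarith))).mul huc
  set v := torusMul (fun ξ => (starRingEnd ℂ) (m ξ)) g with hv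
  have hvc : Continuous v := continuous_torusMul hm' g
  have hrp : ∀ t : ℝ, 0 ≤ t → t ^ (p - 2) * (t * t) = t ^ p := fun t ht => by
    rcases ht.eq_or_lt with rfl | ht
    · simp [Real.zero_rpow hp0.ne']
    · rw [← sq, ← Real.rpow_natCast, ← Real.rpow_add ht]
      norm_num
  have hgn : ∀ x, ‖g x‖ ^ q = ‖u x‖ ^ p := fun x => by
    have e : ‖g x‖ = ‖u x‖ ^ (p - 1) := by
      simp only [g]
      rw [norm_mul, Complex.norm_real, Real.norm_of_nonneg (by positivity)]
      rcases (norm_nonneg (u x)).eq_or_lt with h | h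
      · rw [← h, mul_zero, Real.zero_rpow (by linarith)]
      · nth_rewrite 2 [← Real.rpow_one ‖u x‖]
        rw [← Real.rpow_add h]
        congr 1
        ring
    rw [e, ← Real.rpow_mul (norm_nonneg _), hpq.sub_one_mul_conj]
  set X := ∫ x, ‖u x‖ ^ p ∂haarTorus n with hX
  have hX0 : 0 ≤ X := integral_nonneg fun _ => by positivity
  set Y := (∫ x, ‖f x‖ ^ p ∂haarTorus n) ^ (1 / p) with hY
  have hY0 : 0 ≤ Y := Real.rpow_nonneg (integral_nonneg fun _ => by positivity) _
  have key : X ≤ Y * (D * X) ^ (1 / q) := by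
    have e1 : ((X : ℝ) : ℂ) = ∫ x, f x * (starRingEnd ℂ) (v x) ∂haarTorus n := by
      rw [hv, ← integral_torusMul_mul_conj_eq hm hf.integrable_haarTorus hgc.integrable_haarTorus,
        hX, ← integral_complex_ofReal]
      refine integral_congr_ae (.of_forall fun x => ?_)
      simp only [g, map_mul, Complex.conj_ofReal]
      rw [← hrp _ (norm_nonneg _), ← hu]
      push_cast
      rw [mul_left_comm (u x), Complex.mul_conj, Complex.normSq_eq_norm_sq]
      push_cast
      ring
    have e2 : X ≤ ∫ x, ‖f x‖ * ‖v x‖ ∂haarTorus n := by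
      have h := norm_integral_le_integral_norm (μ := haarTorus n)
        fun x => f x * (starRingEnd ℂ) (v x)
      rw [← e1, Complex.norm_real, Real.norm_of_nonneg hX0] at h
      simpa only [norm_mul, RCLike.norm_conj] using h
    refine e2.trans ((integral_mul_le_Lp_mul_Lq_of_nonneg hpq (.of_forall fun x => norm_nonneg _)
      (.of_forall fun x => norm_nonneg _) (hf.norm.memLp_haarTorus _)
      (hvc.norm.memLp_haarTorus _)).trans ?_)
    refine mul_le_mul_of_nonneg_left ?_ hY0
    refine Real.rpow_le_rpow (integral_nonneg fun _ => by positivity) ?_ (by positivity)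
    refine (hdual g hgc).trans_eq ?_
    simp_rw [hgn]
    rfl
  rcases hX0.eq_or_lt with h0 | hpos
  · rw [← h0, Real.zero_rpow (by positivity)]
    positivity
  · rw [Real.mul_rpow hD hX0] at key
    have e : X = X ^ (1 / p) * X ^ (1 / q) := by
      rw [← Real.rpow_add hpos, one_div, one_div, hpq.inv_add_inv_eq_one, Real.rpow_one]
    have hXq : 0 < X ^ (1 / q) := Real.rpow_pos_of_pos hpos _
    refine le_of_mul_le_mul_right ?_ hXq
    rw [← e]
    refine key.trans_eq ?_
    ring

lemma integral_sq_rpow_torusMul_le {m : (Fin n → ℤ) → ℂ} (hm : m.support.Finite) {A : ℝ}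
    (hA : ∀ ξ, ‖m ξ‖ ≤ A) {f : UnitAddTorus (Fin n) → ℂ} (hf : Continuous f) :
    ∫ x, ‖torusMul m f x‖ ^ (2 : ℝ) ∂haarTorus n
      ≤ A ^ 2 * ∫ x, ‖f x‖ ^ (2 : ℝ) ∂haarTorus n := by
  simp_rw [Real.rpow_two]
  exact integral_sq_torusMul_le hm hA (hf.memLp_haarTorus 2)

end LpBound

section Truncated

variable {n : ℕ}

lemma IsDyadicCutoff.finite_support {k : ℕ} {B : ℝ} {Φ : ℕ → (Fin n → ℤ) → ℂ}
    (hΦ : IsDyadicCutoff k B Φ) (σ : (Fin n → ℤ) → ℂ) (N : ℕ) :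
    (fun ξ => σ ξ * Φ N ξ).support.Finite := by
  refine finite_support_of_norm (N := 2 ^ N) fun ξ hξ => ?_
  rw [hΦ.eq_zero N ξ (by exact_mod_cast hξ), mul_zero]

lemma IsSymbol.norm_mul_cutoff_le {k : ℕ} {B C : ℝ} {σ : (Fin n → ℤ) → ℂ}
    {Φ : ℕ → (Fin n → ℤ) → ℂ} (hσ : IsSymbol k C σ) (hΦ : IsDyadicCutoff k B Φ) (N : ℕ)
    (ξ : Fin n → ℤ) : ‖σ ξ * Φ N ξ‖ ≤ C := by
  rw [norm_mul]
  exact (mul_le_mul (hσ.norm_le ξ) (hΦ.norm_le_one N ξ) (norm_nonneg _) hσ.pos.le).trans_eq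
    (mul_one C)

lemma exists_weak_type_truncated {k : ℕ} (hn : 1 ≤ n) (hk : n < 2 * k) (B C : ℝ) :
    ∃ W : ℝ, 0 < W ∧ ∀ (σ : (Fin n → ℤ) → ℂ) (Φ : ℕ → (Fin n → ℤ) → ℂ), IsSymbol k C σ →
      IsDyadicCutoff k B Φ → ∀ (N : ℕ) (f : UnitAddTorus (Fin n) → ℂ), Continuous f →
      ∀ L : ℝ, 0 < L → haarTorus n {x | L < ‖torusMul (fun ξ => σ ξ * Φ N ξ) f x‖} ≤
        ENNReal.ofReal (W * ((∫ x, ‖f x‖ ∂haarTorus n) / L)) := by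
  obtain ⟨H, hH0, hH⟩ := exists_hormander hn hk B C
  refine ⟨12 * C ^ 2 * (2 ^ n + 2) + 4 ^ n + 4 * H + 1, by positivity,
    fun σ Φ hσ hΦ N f hf L hL => ?_⟩
  exact weak_type_torusMul (hΦ.finite_support σ N) (hσ.norm_mul_cutoff_le hΦ N) hH0.le
    (fun i y hy => hH σ Φ hσ hΦ N i y hy) hf hL

lemma exists_Lp_bound_truncated {k : ℕ} (hn : 1 ≤ n) (hk : n < 2 * k) (B C : ℝ) {p : ℝ}
    (hp : 1 < p) :
    ∃ D : ℝ, 0 < D ∧ ∀ (σ : (Fin n → ℤ) → ℂ) (Φ : ℕ → (Fin n → ℤ) → ℂ), IsSymbol k C σ →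
      IsDyadicCutoff k B Φ → ∀ (N : ℕ) (f : UnitAddTorus (Fin n) → ℂ), Continuous f →
      (∫ x, ‖torusMul (fun ξ => σ ξ * Φ N ξ) f x‖ ^ p ∂haarTorus n) ^ (1 / p)
        ≤ D * (∫ x, ‖f x‖ ^ p ∂haarTorus n) ^ (1 / p) := by
  have hp0 : 0 < p := by linarith
  have hle2 : ∀ q : ℝ, 1 < q → q ≤ 2 → ∃ D : ℝ, 0 < D ∧
      ∀ (σ : (Fin n → ℤ) → ℂ) (Φ : ℕ → (Fin n → ℤ) → ℂ), IsSymbol k C σ →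
      IsDyadicCutoff k B Φ → ∀ (N : ℕ) (f : UnitAddTorus (Fin n) → ℂ), Continuous f →
      ∫ x, ‖torusMul (fun ξ => σ ξ * Φ N ξ) f x‖ ^ q ∂haarTorus n
        ≤ D * ∫ x, ‖f x‖ ^ q ∂haarTorus n := by
    intro q hq1 hq2
    rcases hq2.lt_or_eq with hq2 | rfl
    · obtain ⟨W, hW0, hW⟩ := exists_weak_type_truncated hn hk B C
      have hq1' : 0 < q - 1 := by linarith
      have hq2' : 0 < 2 - q := by linarith
      refine ⟨q * (4 * C ^ 2 * (1 / q + 1 / (2 - q)) + 2 * W / (q - 1)), by positivity,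
        fun σ Φ hσ hΦ N f hf => ?_⟩
      exact integral_rpow_torusMul_le_of_lt_two (hΦ.finite_support σ N) hq1 hq2
        (hσ.norm_mul_cutoff_le hΦ N) hW0.le (hW σ Φ hσ hΦ N) hf
    · refine ⟨C ^ 2 + 1, by positivity, fun σ Φ hσ hΦ N f hf => ?_⟩
      refine (integral_sq_rpow_torusMul_le (hΦ.finite_support σ N)
        (hσ.norm_mul_cutoff_le hΦ N) hf).trans ?_
      exact mul_le_mul_of_nonneg_right (by linarith) (integral_nonneg fun _ => by positivity)
  rcases le_total p 2 with h2 | h2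
  · obtain ⟨D, hD0, hD⟩ := hle2 p hp h2
    refine ⟨D ^ (1 / p), by positivity, fun σ Φ hσ hΦ N f hf => ?_⟩
    rw [← Real.mul_rpow hD0.le (integral_nonneg fun _ => by positivity)]
    exact Real.rpow_le_rpow (integral_nonneg fun _ => by positivity) (hD σ Φ hσ hΦ N f hf)
      (by positivity)
  · have hpq : p.HolderConjugate (p / (p - 1)) := Real.HolderConjugate.conjExponent hp
    obtain ⟨D, hD0, hD⟩ := hle2 (p / (p - 1)) hpq.symm.lt
      (by rw [div_le_iff₀ (by linarith)]; linarith)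
    refine ⟨D ^ (1 / (p / (p - 1))), by positivity, fun σ Φ hσ hΦ N f hf => ?_⟩
    refine integral_rpow_torusMul_le_of_dual (hΦ.finite_support σ N) h2 hpq hD0.le
      (fun g hg => ?_) hf
    have e : (fun ξ => (starRingEnd ℂ) (σ ξ * Φ N ξ))
        = fun ξ => (starRingEnd ℂ) (σ ξ) * Φ N ξ := by
      funext ξ
      rw [map_mul, hΦ.conj]
    rw [e]
    exact hD _ Φ hσ.conj hΦ N g hg

end Truncated

section CutoffLimit

variable {n : ℕ}

lemma IsDyadicCutoff.eventually_eq_one {k : ℕ} {B : ℝ} {Φ : ℕ → (Fin n → ℤ) → ℂ}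
    (hΦ : IsDyadicCutoff k B Φ) (ξ : Fin n → ℤ) : ∀ᶠ N in Filter.atTop, Φ N ξ = 1 := by
  have h : Filter.Tendsto (fun N : ℕ => (2 : ℝ) ^ N / 2) Filter.atTop Filter.atTop :=
    (tendsto_pow_atTop_atTop_of_one_lt (one_lt_two (α := ℝ))).atTop_div_const two_pos
  filter_upwards [h.eventually_ge_atTop ‖ξ‖] with N hN
  exact hΦ.eq_one N ξ hN

lemma norm_mul_mFourier (c : ℂ) (ξ : Fin n → ℤ) (t : UnitAddTorus (Fin n)) :
    ‖c * UnitAddTorus.mFourier ξ t‖ = ‖c‖ := by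
  rw [norm_mul, norm_mFourier_apply, mul_one]

lemma torusMul_eq_zero_of_not_summable {σ : (Fin n → ℤ) → ℂ} {F : UnitAddTorus (Fin n) → ℂ}
    (h : ¬ Summable fun ξ => ‖σ ξ * torusCoeff F ξ‖) (t : UnitAddTorus (Fin n)) :
    torusMul σ F t = 0 := by
  refine tsum_eq_zero_of_not_summable fun hs => h ?_
  simpa only [norm_mul_mFourier] using hs.norm

/-- The truncated multipliers converge uniformly when the multiplier series converges absolutely. -/
lemma tendstoUniformly_torusMul_cutoff {k : ℕ} {B : ℝ} {Φ : ℕ → (Fin n → ℤ) → ℂ}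
    (hΦ : IsDyadicCutoff k B Φ) {σ : (Fin n → ℤ) → ℂ} {F : UnitAddTorus (Fin n) → ℂ}
    (h : Summable fun ξ => ‖σ ξ * torusCoeff F ξ‖) :
    TendstoUniformly (fun N => torusMul (fun ξ => σ ξ * Φ N ξ) F) (torusMul σ F) Filter.atTop := by
  set c : (Fin n → ℤ) → ℂ := fun ξ => σ ξ * torusCoeff F ξ with hc
  have hle : ∀ N ξ, ‖(1 - Φ N ξ) * c ξ‖ ≤ 2 * ‖c ξ‖ := fun N ξ => by
    rw [norm_mul]
    have h1 : ‖1 - Φ N ξ‖ ≤ 2 := by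
      have h2 := norm_sub_le (1 : ℂ) (Φ N ξ)
      have h3 := hΦ.norm_le_one N ξ
      rw [norm_one] at h2
      linarith
    gcongr
  have hs : ∀ N, Summable fun ξ => ‖(1 - Φ N ξ) * c ξ‖ := fun N =>
    (h.mul_left 2).of_nonneg_of_le (fun _ => norm_nonneg _) (hle N)
  have hlim : Filter.Tendsto (fun N => ∑' ξ, ‖(1 - Φ N ξ) * c ξ‖) Filter.atTop
      (nhds (∑' _ : Fin n → ℤ, (0 : ℝ))) := by
    refine tendsto_tsum_of_dominated_convergence (h.mul_left 2) (fun ξ => ?_)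
      (Filter.Eventually.of_forall fun N ξ => (norm_norm _).trans_le (hle N ξ))
    refine tendsto_const_nhds.congr' ?_
    filter_upwards [hΦ.eventually_eq_one ξ] with N hN
    simp [hN]
  rw [tsum_zero] at hlim
  rw [Metric.tendstoUniformly_iff]
  intro ε hε
  filter_upwards [hlim.eventually_lt_const hε] with N hN t
  refine lt_of_le_of_lt ?_ hN
  have hs1 : Summable fun ξ => c ξ * UnitAddTorus.mFourier ξ t :=
    Summable.of_norm (by simpa only [norm_mul_mFourier] using h)
  have hs2 : Summable fun ξ => (1 - Φ N ξ) * c ξ * UnitAddTorus.mFourier ξ t :=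
    Summable.of_norm (by simpa only [norm_mul_mFourier] using hs N)
  have hs3 : torusMul (fun ξ => σ ξ * Φ N ξ) F t
      = ∑' ξ, (c ξ * UnitAddTorus.mFourier ξ t - (1 - Φ N ξ) * c ξ * UnitAddTorus.mFourier ξ t) :=
    tsum_congr fun ξ => by simp only [hc]; ring
  rw [hs3, hs1.tsum_sub hs2, dist_eq_norm]
  have hs4 : torusMul σ F t = ∑' ξ, c ξ * UnitAddTorus.mFourier ξ t := rfl
  rw [hs4, _root_.sub_sub_cancel]
  refine (norm_tsum_le_tsum_norm hs2.norm).trans_eq (tsum_congr fun ξ => norm_mul_mFourier _ _ _)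

lemma continuous_torusMul_of_isDyadicCutoff {k : ℕ} {B : ℝ} {Φ : ℕ → (Fin n → ℤ) → ℂ}
    (hΦ : IsDyadicCutoff k B Φ) (σ : (Fin n → ℤ) → ℂ) (F : UnitAddTorus (Fin n) → ℂ) :
    Continuous (torusMul σ F) := by
  by_cases h : Summable fun ξ => ‖σ ξ * torusCoeff F ξ‖
  · exact (tendstoUniformly_torusMul_cutoff hΦ h).continuous
      (Filter.Frequently.of_forall fun N => continuous_torusMul (hΦ.finite_support σ N) F)
  · rw [show torusMul σ F = fun _ => 0 from funext (torusMul_eq_zero_of_not_summable h)]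
    exact continuous_const

lemma exists_weak_type {k : ℕ} (hn : 1 ≤ n) (hk : n < 2 * k) (C : ℝ) :
    ∃ W, 0 < W ∧ ∀ σ : (Fin n → ℤ) → ℂ, IsSymbol k C σ →
      ∀ F : UnitAddTorus (Fin n) → ℂ, Continuous F → ∀ L, 0 < L →
        haarTorus n {x | L < ‖torusMul σ F x‖}
          ≤ ENNReal.ofReal (W * ((∫ x, ‖F x‖ ∂haarTorus n) / L)) := by
  obtain ⟨B, Φ, hΦ⟩ := exists_isDyadicCutoff n k
  obtain ⟨W, hW, hweak⟩ := exists_weak_type_truncated hn hk B C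
  refine ⟨W, hW, fun σ hσ F hF L hL => ?_⟩
  by_cases h : Summable fun ξ => ‖σ ξ * torusCoeff F ξ‖
  · have hlim : Filter.Tendsto
        (fun ε => ENNReal.ofReal (W * ((∫ x, ‖F x‖ ∂haarTorus n) / (L - ε))))
        (nhdsWithin 0 (Set.Ioi 0))
        (nhds (ENNReal.ofReal (W * ((∫ x, ‖F x‖ ∂haarTorus n) / (L - 0))))) := by
      refine tendsto_nhdsWithin_of_tendsto_nhds (ENNReal.continuous_ofReal.continuousAt.tendsto.comp
        (ContinuousAt.tendsto (f := fun ε => W * ((∫ x, ‖F x‖ ∂haarTorus n) / (L - ε))) ?_))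
      exact continuousAt_const.mul (continuousAt_const.div (by fun_prop) (by simpa using hL.ne'))
    rw [sub_zero] at hlim
    refine ge_of_tendsto hlim ?_
    filter_upwards [Ioo_mem_nhdsGT hL] with ε hε
    obtain ⟨N, hN⟩ := (Metric.tendstoUniformly_iff.1
      (tendstoUniformly_torusMul_cutoff hΦ h) ε hε.1).exists
    refine le_trans (measure_mono fun x (hx : L < _) => ?_)
      (hweak σ Φ hσ hΦ N F hF (L - ε) (sub_pos.2 hε.2))
    have h1 := hN x
    rw [dist_eq_norm] at h1
    have h2 := norm_sub_norm_le (torusMul σ F x) (torusMul (fun ξ => σ ξ * Φ N ξ) F x)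
    change L - ε < _
    linarith
  · simp [torusMul_eq_zero_of_not_summable h, hL.le.not_gt]

lemma exists_Lp_bound {k : ℕ} (hn : 1 ≤ n) (hk : n < 2 * k) (C : ℝ) {p : ℝ} (hp : 1 < p) :
    ∃ D, 0 < D ∧ ∀ σ : (Fin n → ℤ) → ℂ, IsSymbol k C σ →
      ∀ F : UnitAddTorus (Fin n) → ℂ, Continuous F →
        (∫ x, ‖torusMul σ F x‖ ^ p ∂haarTorus n) ^ (1 / p)
          ≤ D * (∫ x, ‖F x‖ ^ p ∂haarTorus n) ^ (1 / p) := by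
  obtain ⟨B, Φ, hΦ⟩ := exists_isDyadicCutoff n k
  obtain ⟨D, hD, hbound⟩ := exists_Lp_bound_truncated hn hk B C hp
  have hp0 : 0 < p := one_pos.trans hp
  refine ⟨D, hD, fun σ hσ F hF => ?_⟩
  by_cases h : Summable fun ξ => ‖σ ξ * torusCoeff F ξ‖
  · have hunif := tendstoUniformly_torusMul_cutoff hΦ h
    have hlim : Filter.Tendsto
        (fun N => ∫ x, ‖torusMul (fun ξ => σ ξ * Φ N ξ) F x‖ ^ p ∂haarTorus n) Filter.atTop
        (nhds (∫ x, ‖torusMul σ F x‖ ^ p ∂haarTorus n)) := by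
      have hcN := fun N => continuous_torusMul (hΦ.finite_support σ N) F
      refine tendsto_integral_filter_of_dominated_convergence
        (fun x => (‖torusMul σ F x‖ + 1) ^ p)
        (Filter.Eventually.of_forall fun N =>
          ((hcN N).norm.rpow_const fun _ => Or.inr hp0.le).aestronglyMeasurable) ?_
        ?_ (Filter.Eventually.of_forall fun x =>
          ((hunif.tendsto_at x).norm.rpow_const (Or.inr hp0.le)))
      · filter_upwards [Metric.tendstoUniformly_iff.1 hunif 1 one_pos] with N hN
        refine Filter.Eventually.of_forall fun x => ?_
        rw [Real.norm_of_nonneg (by positivity)]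
        have h1 := hN x
        rw [dist_comm, dist_eq_norm] at h1
        have h2 := norm_sub_norm_le (torusMul (fun ξ => σ ξ * Φ N ξ) F x) (torusMul σ F x)
        exact Real.rpow_le_rpow (norm_nonneg _) (by linarith) hp0.le
      · exact Continuous.integrable_haarTorus
          (((continuous_torusMul_of_isDyadicCutoff hΦ σ F).norm.add continuous_const).rpow_const
            fun _ => Or.inr hp0.le)
    exact le_of_tendsto' (hlim.rpow_const (Or.inr (by positivity)))
      fun N => hbound σ Φ hσ hΦ N F hF
  · simp only [torusMul_eq_zero_of_not_summable h, norm_zero, Real.zero_rpow hp0.ne',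
      integral_zero, Real.zero_rpow (one_div_pos.2 hp0).ne']
    exact mul_nonneg hD.le (by positivity)

end CutoffLimit

section Periodization

variable {n : ℕ}

/-- The projection `ℝⁿ → 𝕋ⁿ`. -/
def torusProj (n : ℕ) (x : Fin n → ℝ) : UnitAddTorus (Fin n) := fun j => (x j : UnitAddCircle)

/-- The function on the torus induced by a function on `ℝⁿ`. -/
def torusLift (f : (Fin n → ℝ) → ℂ) (t : UnitAddTorus (Fin n)) : ℂ :=
  f fun j => (AddCircle.equivIoc 1 0 (t j) : ℝ)

lemma isOpenQuotientMap_torusProj : IsOpenQuotientMap (torusProj n) :=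
  IsOpenQuotientMap.piMap fun _ => QuotientAddGroup.isOpenQuotientMap_mk

lemma Per.torusLift_torusProj {f : (Fin n → ℝ) → ℂ} (hf : Per f) (x : Fin n → ℝ) :
    torusLift f (torusProj n x) = f x := by
  have h : ∀ j, ∃ m : ℤ, m • (1 : ℝ) = (AddCircle.equivIoc 1 0 (x j : UnitAddCircle) : ℝ) - x j :=
    fun j => (AddCircle.coe_eq_zero_iff (1 : ℝ)).1 <| by
      rw [AddCircle.coe_sub, AddCircle.coe_equivIoc, sub_self]
  choose m hm using h
  rw [← hf x m]
  refine congrArg f (funext fun j => ?_)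
  have := hm j
  rw [zsmul_one] at this
  rw [Pi.add_apply, this]
  exact (add_sub_cancel _ _).symm

lemma Per.continuous_torusLift {f : (Fin n → ℝ) → ℂ} (hf : Per f) (hc : Continuous f) :
    Continuous (torusLift f) := by
  rw [isOpenQuotientMap_torusProj.isQuotientMap.continuous_iff]
  rwa [show torusLift f ∘ torusProj n = f from funext hf.torusLift_torusProj]

lemma measurePreserving_torusProj : MeasurePreserving (torusProj n) (μT n) (haarTorus n) := by
  have h1 : MeasurePreserving (fun r : ℝ => (r : UnitAddCircle))
      (volume.restrict (Set.Ico (0 : ℝ) 1)) AddCircle.haarAddCircle := by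
    rw [haarAddCircle_eq_volume, Measure.restrict_congr_set Ico_ae_eq_Ioc]
    simpa using UnitAddCircle.measurePreserving_mk 0
  have h2 : μT n = Measure.pi fun _ : Fin n => (volume : Measure ℝ).restrict (Set.Ico (0 : ℝ) 1) :=
    Measure.restrict_pi_pi _ _
  rw [h2]
  exact measurePreserving_pi _ _ fun _ => h1

lemma integral_comp_torusProj {E : Type*} [NormedAddCommGroup E] [NormedSpace ℝ E]
    {G : UnitAddTorus (Fin n) → E} (hG : AEStronglyMeasurable G (haarTorus n)) :
    ∫ x, G (torusProj n x) ∂μT n = ∫ t, G t ∂haarTorus n := by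
  have h := measurePreserving_torusProj (n := n)
  rw [← h.map_eq, integral_map h.measurable.aemeasurable (h.map_eq ▸ hG)]

lemma mFourier_torusProj (ξ : Fin n → ℤ) (x : Fin n → ℝ) :
    UnitAddTorus.mFourier ξ (torusProj n x) = eChar x ξ := by
  rw [eChar, Finset.mul_sum, Complex.exp_sum]
  refine (Finset.prod_congr rfl fun j _ => ?_ :
    ∏ j, fourier (ξ j) (torusProj n x j) = _)
  refine fourier_coe_apply.trans ?_
  congr 1
  push_cast
  ring

lemma fc_eq_torusCoeff {f : (Fin n → ℝ) → ℂ} (hf : Per f) (hc : Continuous f) (ξ : Fin n → ℤ) :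
    fc f ξ = torusCoeff (torusLift f) ξ := by
  rw [torusCoeff, ← integral_comp_torusProj]
  · refine integral_congr_ae (Filter.Eventually.of_forall fun x => ?_)
    simp only [hf.torusLift_torusProj, mFourier_torusProj, eChar, Pi.neg_apply]
    congr 2
    push_cast
    simp only [mul_neg, Finset.sum_neg_distrib, neg_mul]
  · exact ((UnitAddTorus.mFourier (-ξ)).continuous.mul
      (hf.continuous_torusLift hc)).aestronglyMeasurable

lemma Op_eq_torusMul (σ : (Fin n → ℤ) → ℂ) {f : (Fin n → ℝ) → ℂ} (hf : Per f) (hc : Continuous f)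
    (x : Fin n → ℝ) :
    Op (fun _ => σ) f x = torusMul σ (torusLift f) (torusProj n x) := by
  refine tsum_congr fun ξ => ?_
  rw [fc_eq_torusCoeff hf hc, mFourier_torusProj]
  ring

lemma lpT_comp_torusProj (p : ℝ) (hp : 0 ≤ p) {G : UnitAddTorus (Fin n) → ℂ} (hG : Continuous G) :
    lpT n p (fun x => G (torusProj n x)) = (∫ t, ‖G t‖ ^ p ∂haarTorus n) ^ (1 / p) := by
  rw [lpT, integral_comp_torusProj (G := fun t => ‖G t‖ ^ p)
    (hG.norm.rpow_const fun _ => Or.inr hp).aestronglyMeasurable]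

end Periodization

/-- If `k > n/2` is an even integer and `σ : ℤⁿ → ℂ` satisfies
`|Δ_ξ^α σ(ξ)| ≤ C_α ⟨ξ⟩^{-|α|}` for `|α| ≤ k`, then the periodic Fourier multiplier `σ(D)`
is of weak type `(1,1)` and bounded on `L^p(𝕋ⁿ)` for every `1 < p < ∞`. -/
theorem periodic_multiplier_weak11_and_Lp_bounded
    (n : ℕ) (hn : 1 ≤ n) (k : ℕ) (hk_even : Even k) (hk : (n : ℝ) / 2 < k)
    (σ : (Fin n → ℤ) → ℂ)
    (hσ : ∀ α : Fin n → ℕ, (∑ j, α j) ≤ k →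
      ∃ C : ℝ, 0 < C ∧ ∀ ξ : Fin n → ℤ, ‖ddM α σ ξ‖ ≤ C * jb ξ ^ (-(∑ j, (α j : ℝ)))) :
    (∃ C : ℝ, 0 < C ∧ ∀ f : (Fin n → ℝ) → ℂ, ContDiff ℝ (⊤ : ℕ∞) f → Per f →
      ∀ lam : ℝ, 0 < lam →
        μT n {x | lam < ‖Op (fun _ => σ) f x‖} ≤ ENNReal.ofReal (C * lpT n 1 f / lam))
    ∧
    (∀ p : ℝ, 1 < p →
      ∃ C : ℝ, 0 < C ∧ ∀ f : (Fin n → ℝ) → ℂ, ContDiff ℝ (⊤ : ℕ∞) f → Per f →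
        lpT n p (Op (fun _ => σ) f) ≤ C * lpT n p f) := by
  have hk' : n < 2 * k := by
    have : (n : ℝ) < ((2 * k : ℕ) : ℝ) := by push_cast; linarith
    exact_mod_cast this
  obtain ⟨C, hC⟩ := exists_isSymbol k σ hσ
  obtain ⟨B, Φ, hΦ⟩ := exists_isDyadicCutoff n k
  have hOp : ∀ f : (Fin n → ℝ) → ℂ, Per f → Continuous f →
      Op (fun _ => σ) f = fun x => torusMul σ (torusLift f) (torusProj n x) := fun f hf hc =>
    funext (Op_eq_torusMul σ hf hc)
  have hlp : ∀ f : (Fin n → ℝ) → ℂ, Per f → Continuous f → ∀ p : ℝ, 0 ≤ p →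
      lpT n p f = (∫ t, ‖torusLift f t‖ ^ p ∂haarTorus n) ^ (1 / p) := fun f hf hc p hp => by
    rw [← lpT_comp_torusProj p hp (hf.continuous_torusLift hc)]
    exact congrArg _ (funext fun x => (hf.torusLift_torusProj x).symm)
  refine ⟨?_, fun p hp => ?_⟩
  · obtain ⟨W, hW, hweak⟩ := exists_weak_type hn hk' C
    refine ⟨W, hW, fun f hsmooth hf lam hlam => ?_⟩
    have hc := hsmooth.continuous
    have hcont := continuous_torusMul_of_isDyadicCutoff hΦ σ (torusLift f)
    have hset : {x | lam < ‖Op (fun _ => σ) f x‖}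
        = torusProj n ⁻¹' {t | lam < ‖torusMul σ (torusLift f) t‖} := by
      rw [hOp f hf hc]; rfl
    rw [hset, measurePreserving_torusProj.measure_preimage
      (isOpen_lt continuous_const hcont.norm).measurableSet.nullMeasurableSet, hlp f hf hc 1 zero_le_one]
    simp only [Real.rpow_one, div_one, mul_div_assoc]
    exact hweak σ hC _ (hf.continuous_torusLift hc) lam hlam
  · obtain ⟨D, hD, hbound⟩ := exists_Lp_bound hn hk' C hp
    refine ⟨D, hD, fun f hsmooth hf => ?_⟩
    have hc := hsmooth.continuous
    have hp0 : 0 ≤ p := (one_pos.trans hp).le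
    rw [hlp f hf hc p hp0, hOp f hf hc,
      lpT_comp_torusProj p hp0 (continuous_torusMul_of_isDyadicCutoff hΦ σ (torusLift f))]
    exact hbound σ hC _ (hf.continuous_torusLift hc)
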